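/- The fundamental group π₁𝒰ℛ_n is isomorphic to the group with presentation having generators ρ_1,…,ρ_{n−1}, σ_1,…,σ_{n−1} and relations: ρ_iρ_j = ρ_jρ_i, σ_iσ_j = σ_jσ_i, ρ_iσ_j = σ_jρ_i whenever |i−j| ≥ 2; ρ_iρ_{i+1}ρ_i = ρ_{i+1}ρ_iρ_{i+1} and σ_iσ_{i+1}σ_i = σ_{i+1}σ_iσ_{i+1}; ρ_iσ_{i+1}σ_i = σ_{i+1}σ_iρ_{i+1}, σ_iσ_{i+1}ρ_i = ρ_{i+1}σ_iσ_{i+1}, σ_iρ_{i+1}ρ_i = ρ_{i+1}ρ_iσ_{i+1}; together with σ_i² = 1 for all i. -/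

import Mathlib

noncomputable section

open CategoryTheory

abbrev E2 : Type := EuclideanSpace ℝ (Fin 2)
abbrev E3 : Type := EuclideanSpace ℝ (Fin 3)

/-- The round circle in `ℝ³` with center `c`, radius `r` and normal `v`. -/
def circleSet (c : E3) (r : ℝ) (v : E3) : Set E3 :=
  {x | ‖x - c‖ = r ∧ inner ℝ (x - c) v = (0 : ℝ)}

/-- The spanning disk of the round circle with center `c`, radius `r` and normal `v`. -/
def diskSet (c : E3) (r : ℝ) (v : E3) : Set E3 :=
  {x | ‖x - c‖ ≤ r ∧ inner ℝ (x - c) v = (0 : ℝ)}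

/-- The circle determined by a parameter pair (center, normal vector `w`):
it has radius `‖w‖` and unit normal `w / ‖w‖` (so `w` and `-w` give the same circle). -/
def pCircle (p : E3 × E3) : Set E3 := circleSet p.1 ‖p.2‖ p.2

/-- The spanning disk of the circle determined by a parameter pair. -/
def pDisk (p : E3 × E3) : Set E3 := diskSet p.1 ‖p.2‖ p.2

/-- The first circle meets the spanning disk of the second in exactly one point. -/
def LinksOnce (p q : E3 × E3) : Prop := ∃! x, x ∈ pCircle p ∩ pDisk q

/-- Two round circles are unlinked if neither meets the spanning disk of the other in
exactly one point. -/
def UnlinkedPair (p q : E3 × E3) : Prop := ¬ LinksOnce p q ∧ ¬ LinksOnce q p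

/-- An `n`-tuple of parameters of (nondegenerate) pairwise disjoint, pairwise unlinked
round circles. -/
def IsRingTuple {n : ℕ} (f : Fin n → E3 × E3) : Prop :=
  (∀ i, (f i).2 ≠ 0) ∧
  (∀ i j, i ≠ j → Disjoint (pCircle (f i)) (pCircle (f j))) ∧
  (∀ i j, i ≠ j → UnlinkedPair (f i) (f j))

/-- The space of ordered `n`-tuples of disjoint pairwise unlinked round circles. -/
abbrev RingTuple (n : ℕ) : Type := {f : Fin n → E3 × E3 // IsRingTuple f}

/-- Two tuples are identified iff they determine the same `n`-element set of circles
(this identifies `w` with `-w` and permutes the circles). -/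
def ringSetoid (n : ℕ) : Setoid (RingTuple n) where
  r f g := (Set.range fun i => pCircle (f.1 i)) = Set.range fun i => pCircle (g.1 i)
  iseqv := ⟨fun _ => rfl, Eq.symm, Eq.trans⟩

/-- The space `ℛ_n` of configurations of `n` disjoint pairwise unlinked round circles
in `ℝ³`, with the quotient topology. -/
abbrev RingConf (n : ℕ) : Type := Quotient (ringSetoid n)

/-- All circles of the tuple lie in planes parallel to the `yz`-plane, i.e. every
normal vector is parallel to `(1,0,0)`. -/
def IsUntwistedTuple {n : ℕ} (f : RingTuple n) : Prop :=
  ∀ i, (f.1 i).2 1 = 0 ∧ (f.1 i).2 2 = 0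

/-- All circles of the tuple lie in vertical planes, i.e. every normal vector is
horizontal (third coordinate zero). -/
def IsVerticalTuple {n : ℕ} (f : RingTuple n) : Prop := ∀ i, (f.1 i).2 2 = 0

/-- The untwisted ring space `𝒰ℛ_n ⊆ ℛ_n`: configurations of rings parallel to the
`yz`-plane. -/
def URConf (n : ℕ) : Set (RingConf n) :=
  {x | ∃ f, Quotient.mk (ringSetoid n) f = x ∧ IsUntwistedTuple f}

/-- The vertical ring space `𝒱ℛ_n ⊆ ℛ_n`: configurations of rings in vertical planes. -/
def VRConf (n : ℕ) : Set (RingConf n) :=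
  {x | ∃ f, Quotient.mk (ringSetoid n) f = x ∧ IsVerticalTuple f}

/-- Generators `ρ_0, …, ρ_{n-2}` and `σ_0, …, σ_{n-2}` (indexed from 0). -/
abbrev BrGen (n : ℕ) : Type := Fin (n - 1) ⊕ Fin (n - 1)

/-- The generator `ρ_i`. -/
def gρ {n : ℕ} (i : Fin (n - 1)) : FreeGroup (BrGen n) := FreeGroup.of (Sum.inl i)

/-- The generator `σ_i`. -/
def gσ {n : ℕ} (i : Fin (n - 1)) : FreeGroup (BrGen n) := FreeGroup.of (Sum.inr i)

/-- The relations `ρ_iρ_j = ρ_jρ_i`, `σ_iσ_j = σ_jσ_i`, `ρ_iσ_j = σ_jρ_i` for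
`|i-j| ≥ 2`; `ρ_iρ_{i+1}ρ_i = ρ_{i+1}ρ_iρ_{i+1}`, `σ_iσ_{i+1}σ_i = σ_{i+1}σ_iσ_{i+1}`;
`ρ_iσ_{i+1}σ_i = σ_{i+1}σ_iρ_{i+1}`, `σ_iσ_{i+1}ρ_i = ρ_{i+1}σ_iσ_{i+1}`,
`σ_iρ_{i+1}ρ_i = ρ_{i+1}ρ_iσ_{i+1}`, written as relators. -/
def uwRels (n : ℕ) : Set (FreeGroup (BrGen n)) :=
  (⋃ (i : Fin (n - 1)) (j : Fin (n - 1)) (_ : (i : ℕ) + 2 ≤ (j : ℕ) ∨ (j : ℕ) + 2 ≤ (i : ℕ)),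
    {gρ i * gρ j * (gρ j * gρ i)⁻¹, gσ i * gσ j * (gσ j * gσ i)⁻¹,
      gρ i * gσ j * (gσ j * gρ i)⁻¹}) ∪
  (⋃ (i : Fin (n - 1)) (j : Fin (n - 1)) (_ : (j : ℕ) = (i : ℕ) + 1),
    {gρ i * gρ j * gρ i * (gρ j * gρ i * gρ j)⁻¹,
      gσ i * gσ j * gσ i * (gσ j * gσ i * gσ j)⁻¹,
      gρ i * gσ j * gσ i * (gσ j * gσ i * gρ j)⁻¹,
      gσ i * gσ j * gρ i * (gρ j * gσ i * gσ j)⁻¹,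
      gσ i * gρ j * gρ i * (gρ j * gρ i * gσ j)⁻¹})

/-- The relations for `𝒰ℛ_n`: those of `𝒰𝒲_n` together with `σ_i² = 1`. -/
def urRels (n : ℕ) : Set (FreeGroup (BrGen n)) :=
  uwRels n ∪ ⋃ i : Fin (n - 1), {gσ i * gσ i}

namespace URProof

section Potential
variable {G : Type*} [Group G] {α : Type*} [LinearOrder α] (x : ℕ → α → α → G)

def insV : ℕ → α → List α → G
  | _, _, [] => 1
  | k, a, b :: s => if b < a then x k a b * insV (k + 1) a s else 1

def potD : ℕ → List α → G
  | _, [] => 1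
  | k, a :: l => potD (k + 1) l * insV x k a (l.insertionSort (· ≤ ·))

variable {x} {N : ℕ}

theorem insV_commute
    (hcomm : ∀ k l a b c d, k + 2 ≤ l → l + 1 < N → Commute (x k a b) (x l c d))
    (k : ℕ) (a b c : α) (s : List α) : ∀ l, k + 2 ≤ l → l + s.length < N →
      Commute (x k a b) (insV x l c s) := by
  induction s with
  | nil => intro l _ _; exact Commute.one_right _
  | cons d s ih =>
    intro l hl hN
    simp only [List.length_cons] at hN
    unfold insV
    split_ifs
    · exact (hcomm _ _ _ _ _ _ hl (by omega)).mul_right (ih (l + 1) (by omega) (by omega))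
    · exact Commute.one_right _

theorem potD_commute
    (hcomm : ∀ k l a b c d, k + 2 ≤ l → l + 1 < N → Commute (x k a b) (x l c d))
    (k : ℕ) (a b : α) (s : List α) : ∀ l, k + 2 ≤ l → l + s.length ≤ N →
      Commute (x k a b) (potD x l s) := by
  induction s with
  | nil => intro l _ _; exact Commute.one_right _
  | cons d s ih =>
    intro l hl hN
    simp only [List.length_cons] at hN
    unfold potD
    refine (ih (l + 1) (by omega) (by omega)).mul_right (insV_commute hcomm _ _ _ _ _ _ hl ?_)
    rw [List.length_insertionSort]; omega

theorem insV_key_lt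
    (hinv : ∀ k a b, k + 1 < N → x k a b * x k b a = 1)
    (hcomm : ∀ k l a b c d, k + 2 ≤ l → l + 1 < N → Commute (x k a b) (x l c d))
    (hbraid : ∀ k a b c, a ≠ b → a ≠ c → b ≠ c → k + 2 < N →
      x k a b * x (k + 1) a c * x k b c = x (k + 1) b c * x k a c * x (k + 1) a b)
    (a b : α) (hab : a < b) (s : List α) : ∀ k, k + 1 + s.length < N →
      insV x (k + 1) b s * insV x k a (s.orderedInsert (· ≤ ·) b) =
        x k a b * (insV x (k + 1) a s * insV x k b (s.orderedInsert (· ≤ ·) a)) := by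
  induction s with
  | nil =>
    intro k hk
    simp [insV, hab, hab.not_gt, hinv k a b (by simpa using hk)]
  | cons c s ih =>
    intro k hk
    simp only [List.length_cons] at hk
    by_cases hca : c < a
    · have hcb : c < b := hca.trans hab
      simp only [List.orderedInsert, hca.not_ge, hcb.not_ge, if_false, insV, hca, hcb, if_true]
      have e1 := (insV_commute hcomm k a c b s (k + 2) (by omega) (by omega)).eq
      have e2 := (insV_commute hcomm k b c a s (k + 2) (by omega) (by omega)).eq
      have e3 := ih (k + 1) (by omega)
      have e4 := hbraid k a b c hab.ne hca.ne' hcb.ne' (by omega)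
      simp only [show k + 1 + 1 = k + 2 from rfl] at *
      calc _ = x (k+1) b c * (insV x (k+2) b s * x k a c) *
              insV x (k+1) a (s.orderedInsert (· ≤ ·) b) := by group
        _ = x (k+1) b c * x k a c *
              (insV x (k+2) b s * insV x (k+1) a (s.orderedInsert (· ≤ ·) b)) := by
            rw [← e1]; group
        _ = (x (k+1) b c * x k a c * x (k+1) a b) * (insV x (k + 2) a s *
              insV x (k + 1) b (s.orderedInsert (· ≤ ·) a)) := by rw [e3]; group
        _ = x k a b * x (k+1) a c * (x k b c * insV x (k + 2) a s) *
              insV x (k + 1) b (s.orderedInsert (· ≤ ·) a) := by rw [← e4]; group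
        _ = _ := by rw [e2]; group
    · have hac : a ≤ c := not_lt.mp hca
      have h1 : insV x k a ((c :: s).orderedInsert (· ≤ ·) b) = 1 := by
        by_cases hbc : b ≤ c
        · simp [List.orderedInsert, hbc, insV, hab.not_gt]
        · simp [List.orderedInsert, hbc, insV, hca]
      have h2 : insV x (k+1) a (c :: s) = 1 := by simp [insV, hca]
      have h3 : (c :: s).orderedInsert (· ≤ ·) a = a :: c :: s := by
        simp [List.orderedInsert, hac]
      have h4 : insV x k b (a :: c :: s) = x k b a * insV x (k + 1) b (c :: s) := by
        rw [insV, if_pos hab]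
      rw [h1, h2, h3, h4, mul_one, one_mul, ← mul_assoc, hinv k a b (by omega),
        one_mul]

theorem insV_key
    (hinv : ∀ k a b, k + 1 < N → x k a b * x k b a = 1)
    (hcomm : ∀ k l a b c d, k + 2 ≤ l → l + 1 < N → Commute (x k a b) (x l c d))
    (hbraid : ∀ k a b c, a ≠ b → a ≠ c → b ≠ c → k + 2 < N →
      x k a b * x (k + 1) a c * x k b c = x (k + 1) b c * x k a c * x (k + 1) a b)
    (a b : α) (hab : a ≠ b) (s : List α) (k : ℕ) (hk : k + 1 + s.length < N) :
      insV x (k + 1) b s * insV x k a (s.orderedInsert (· ≤ ·) b) =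
        x k a b * (insV x (k + 1) a s * insV x k b (s.orderedInsert (· ≤ ·) a)) := by
  rcases lt_or_gt_of_ne hab with h | h
  · exact insV_key_lt hinv hcomm hbraid a b h s k hk
  · rw [insV_key_lt hinv hcomm hbraid b a h s k hk, ← mul_assoc, hinv k a b (by omega), one_mul]

theorem potD_swap
    (hinv : ∀ k a b, k + 1 < N → x k a b * x k b a = 1)
    (hcomm : ∀ k l a b c d, k + 2 ≤ l → l + 1 < N → Commute (x k a b) (x l c d))
    (hbraid : ∀ k a b c, a ≠ b → a ≠ c → b ≠ c → k + 2 < N →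
      x k a b * x (k + 1) a c * x k b c = x (k + 1) b c * x k a c * x (k + 1) a b)
    (a b : α) (hab : a ≠ b) (l2 : List α) (l1 : List α) : ∀ k, k + l1.length + 2 + l2.length ≤ N →
      potD x k (l1 ++ a :: b :: l2) = x (k + l1.length) a b * potD x k (l1 ++ b :: a :: l2) := by
  induction l1 with
  | nil =>
    intro k hk
    simp only [List.length_nil, add_zero] at hk
    simp only [List.nil_append, potD, List.length_nil, add_zero, List.insertionSort_cons]
    have e := insV_key hinv hcomm hbraid a b hab (l2.insertionSort (· ≤ ·)) k
      (by rw [List.length_insertionSort]; omega)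
    have e1 := (potD_commute hcomm k a b l2 (k + 2) le_rfl (by omega)).eq
    rw [show k + 1 + 1 = k + 2 from rfl, mul_assoc, e, ← mul_assoc, ← mul_assoc, ← e1]
    group
  | cons c l1 ih =>
    intro k hk
    simp only [List.length_cons] at hk
    simp only [List.cons_append, potD, List.length_cons]
    have : (l1 ++ a :: b :: l2).insertionSort (· ≤ ·) = (l1 ++ b :: a :: l2).insertionSort (· ≤ ·) := by
      apply List.Perm.eq_of_pairwise (le := (· ≤ ·))
      · intro a b _ _ h1 h2; exact le_antisymm h1 h2
      · exact List.pairwise_insertionSort _ _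
      · exact List.pairwise_insertionSort _ _
      · refine (List.perm_insertionSort _ _).trans (List.Perm.trans ?_ (List.perm_insertionSort _ _).symm)
        exact List.Perm.append_left _ (List.Perm.swap _ _ _)
    rw [ih (k + 1) (by omega), this, show k + 1 + l1.length = k + (l1.length + 1) by omega]
    group

end Potential

/-! ### Adjacent transpositions and galleries -/

def sw {n : ℕ} (k : ℕ) (hk : k + 1 < n) : Equiv.Perm (Fin n) :=
  Equiv.swap ⟨k, by omega⟩ ⟨k + 1, hk⟩

theorem sw_left {n : ℕ} (k : ℕ) (hk : k + 1 < n) : sw k hk ⟨k, by omega⟩ = ⟨k + 1, hk⟩ :=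
  Equiv.swap_apply_left _ _

theorem sw_right {n : ℕ} (k : ℕ) (hk : k + 1 < n) : sw k hk ⟨k + 1, hk⟩ = ⟨k, by omega⟩ :=
  Equiv.swap_apply_right _ _

theorem sw_ne {n : ℕ} (k : ℕ) (hk : k + 1 < n) (i : Fin n) (h1 : (i : ℕ) ≠ k)
    (h2 : (i : ℕ) ≠ k + 1) : sw k hk i = i :=
  Equiv.swap_apply_of_ne_of_ne (fun h => h1 (congrArg Fin.val h)) (fun h => h2 (congrArg Fin.val h))

theorem sw_mul_self {n : ℕ} (k : ℕ) (hk : k + 1 < n) : sw k hk * sw k hk = 1 :=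
  Equiv.swap_mul_self _ _

theorem sw_lt {n : ℕ} (k : ℕ) (hk : k + 1 < n) (i j : Fin n) (hij : i < j) :
    sw k hk i < sw k hk j ∨ ((i : ℕ) = k ∧ (j : ℕ) = k + 1) := by
  have hi : ∀ i : Fin n, ((i : ℕ) = k ∧ (sw k hk i : ℕ) = k + 1) ∨
      ((i : ℕ) = k + 1 ∧ (sw k hk i : ℕ) = k) ∨
      ((i : ℕ) ≠ k ∧ (i : ℕ) ≠ k + 1 ∧ (sw k hk i : ℕ) = i) := by
    intro i
    by_cases h1 : (i : ℕ) = k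
    · left
      refine ⟨h1, ?_⟩
      have : i = ⟨k, by omega⟩ := Fin.ext h1
      rw [this, sw_left]
    · by_cases h2 : (i : ℕ) = k + 1
      · right; left
        refine ⟨h2, ?_⟩
        have : i = ⟨k + 1, by omega⟩ := Fin.ext h2
        rw [this, sw_right]
      · right; right
        exact ⟨h1, h2, by rw [sw_ne k hk i h1 h2]⟩
  have a := hi i
  have b := hi j
  rw [Fin.lt_def] at hij ⊢
  omega

theorem perm_eq_one_of_adjacent {n : ℕ} (f : Equiv.Perm (Fin n))
    (h : ∀ k (hk : k + 1 < n), f ⟨k, by omega⟩ < f ⟨k + 1, hk⟩) : f = 1 := by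
  have hm : StrictMono f := by
    rcases n with _ | n
    · intro i; exact i.elim0
    · rw [Fin.strictMono_iff_lt_succ]
      intro i
      exact h i (by omega)
  have := Subsingleton.elim (hm.orderIsoOfSurjective f f.surjective) (OrderIso.refl (Fin n))
  ext i
  have h2 := congrArg (fun g : Fin n ≃o Fin n => g i) this
  simpa using congrArg Fin.val h2

theorem gallery {n : ℕ} (Agr : Fin n → Fin n → Prop) (π' : Equiv.Perm (Fin n))
    (Q : Equiv.Perm (Fin n) → Prop)
    (hstep : ∀ π k (hk : k + 1 < n), Q π → Agr (π ⟨k, by omega⟩) (π ⟨k + 1, hk⟩) →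
      Q (π * sw k hk)) :
    ∀ π : Equiv.Perm (Fin n),
      (∀ i j, i < j → π'⁻¹ (π j) < π'⁻¹ (π i) → Agr (π i) (π j)) → Q π → Q π' := by
  have wf : WellFounded (fun a b : Lex (Fin n → Fin n) => a < b) := wellFounded_lt
  suffices H : ∀ (f : Lex (Fin n → Fin n)) (π : Equiv.Perm (Fin n)),
      f = toLex (fun i => π'⁻¹ (π i)) →
      (∀ i j, i < j → π'⁻¹ (π j) < π'⁻¹ (π i) → Agr (π i) (π j)) → Q π → Q π' from
    fun π => H _ π rfl
  intro f
  induction f using wf.induction with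
  | _ f ih =>
    intro π hf hA hQ
    by_cases hone : ∀ k (hk : k + 1 < n), (π'⁻¹ * π) ⟨k, by omega⟩ < (π'⁻¹ * π) ⟨k + 1, hk⟩
    · have h1 := perm_eq_one_of_adjacent _ hone
      have : π = π' := by rw [inv_mul_eq_one] at h1; exact h1.symm
      rwa [← this]
    · push Not at hone
      obtain ⟨k, hk, hle⟩ := hone
      have hlt : π'⁻¹ (π ⟨k + 1, hk⟩) < π'⁻¹ (π ⟨k, by omega⟩) := by
        refine lt_of_le_of_ne hle fun h => ?_
        have := congrArg Fin.val (π.injective (π'⁻¹.injective h))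
        simp at this
      refine ih (toLex fun i => π'⁻¹ ((π * sw k hk) i)) ?_ (π * sw k hk) rfl ?_ ?_
      · rw [hf]
        refine ⟨⟨k, by omega⟩, ?_, ?_⟩
        · intro j hj
          have hj' : (j : ℕ) < k := hj
          simp [sw_ne k hk j (by omega) (by omega)]
        · simpa [sw_left] using hlt
      · intro i j hij hinv
        rcases sw_lt k hk i j hij with h | ⟨h1, h2⟩
        · exact hA _ _ h hinv
        · have hk0 : k < n := by omega
          have e1 : i = ⟨k, hk0⟩ := Fin.ext h1
          have e2 : j = ⟨k + 1, hk⟩ := Fin.ext h2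
          rw [e1, e2] at hinv
          simp only [Equiv.Perm.mul_apply, sw_left, sw_right] at hinv
          exact absurd hinv hlt.not_gt
      · exact hstep π k hk hQ (hA _ _ (by simp [Fin.lt_def]) hlt)

/-! ### The relations -/

structure Rels {A : Type*} [Group A] (n : ℕ) (ρ σ : ℕ → A) : Prop where
  rr : ∀ k l, k + 2 ≤ l → l + 1 < n → Commute (ρ k) (ρ l)
  ss : ∀ k l, k + 2 ≤ l → l + 1 < n → Commute (σ k) (σ l)
  rs : ∀ k l, k + 2 ≤ l → l + 1 < n → Commute (ρ k) (σ l)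
  sr : ∀ k l, k + 2 ≤ l → l + 1 < n → Commute (σ k) (ρ l)
  b1 : ∀ k, k + 2 < n → ρ k * ρ (k+1) * ρ k = ρ (k+1) * ρ k * ρ (k+1)
  b2 : ∀ k, k + 2 < n → σ k * σ (k+1) * σ k = σ (k+1) * σ k * σ (k+1)
  b3 : ∀ k, k + 2 < n → ρ k * σ (k+1) * σ k = σ (k+1) * σ k * ρ (k+1)
  b4 : ∀ k, k + 2 < n → σ k * σ (k+1) * ρ k = ρ (k+1) * σ k * σ (k+1)
  b5 : ∀ k, k + 2 < n → σ k * ρ (k+1) * ρ k = ρ (k+1) * ρ k * σ (k+1)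
  sq : ∀ k, k + 1 < n → σ k * σ k = 1

structure Forest {n : ℕ} (I : Fin n → Fin n → Prop) : Prop where
  asymm : ∀ a b, I a b → ¬ I b a
  trans : ∀ a b c, I a b → I b c → I a c
  forest : ∀ a b c, I a b → I a c → b ≠ c → I b c ∨ I c b

open Classical in
def xx {A : Type*} [Group A] (ρ σ : ℕ → A) {n : ℕ} (I : Fin n → Fin n → Prop)
    (k : ℕ) (a b : Fin n) : A :=
  if I a b then ρ k else if I b a then (ρ k)⁻¹ else σ k

theorem xx_congr {A : Type*} [Group A] (ρ σ : ℕ → A) {n : ℕ} {I I' : Fin n → Fin n → Prop}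
    (k : ℕ) {a b a' b' : Fin n} (h1 : I a b ↔ I' a' b') (h2 : I b a ↔ I' b' a') :
    xx ρ σ I k a b = xx ρ σ I' k a' b' := by
  unfold xx
  by_cases h3 : I a b <;> by_cases h4 : I b a <;> simp_all

section Coherence
variable {A : Type*} [Group A] {n : ℕ} {ρ σ : ℕ → A} (h : Rels n ρ σ)
  {I : Fin n → Fin n → Prop} (hI : Forest I)
include h hI

theorem xx_inv (k : ℕ) (a b : Fin n) (hk : k + 1 < n) :
    xx ρ σ I k a b * xx ρ σ I k b a = 1 := by
  have := hI.asymm a b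
  by_cases h1 : I a b <;> by_cases h2 : I b a <;> simp_all [xx, h.sq k hk]

omit hI in
theorem xx_comm (k l : ℕ) (a b c d : Fin n) (hkl : k + 2 ≤ l) (hl : l + 1 < n) :
    Commute (xx ρ σ I k a b) (xx ρ σ I l c d) := by
  have h1 := h.rr k l hkl hl
  have h2 := h.ss k l hkl hl
  have h3 := h.rs k l hkl hl
  have h4 := h.sr k l hkl hl
  unfold xx
  split_ifs <;> simp_all [Commute.inv_left, Commute.inv_right]

theorem xx_braid (k : ℕ) (a b c : Fin n) (hab : a ≠ b) (hac : a ≠ c) (hbc : b ≠ c)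
    (hk : k + 2 < n) :
    xx ρ σ I k a b * xx ρ σ I (k + 1) a c * xx ρ σ I k b c =
      xx ρ σ I (k + 1) b c * xx ρ σ I k a c * xx ρ σ I (k + 1) a b := by
  have b1 := h.b1 k hk
  have b2 := h.b2 k hk
  have b3 := h.b3 k hk
  have b5 := h.b5 k hk
  let B : Fin n → Fin n → Fin n → Prop := fun a b c =>
    xx ρ σ I k a b * xx ρ σ I (k + 1) a c * xx ρ σ I k b c =
      xx ρ σ I (k + 1) b c * xx ρ σ I k a c * xx ρ σ I (k + 1) a b
  have e1 : ∀ a b, xx ρ σ I k b a = (xx ρ σ I k a b)⁻¹ := fun a b =>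
    eq_inv_of_mul_eq_one_left (xx_inv h hI k b a (by omega))
  have e2 : ∀ a b, xx ρ σ I (k+1) b a = (xx ρ σ I (k+1) a b)⁻¹ := fun a b =>
    eq_inv_of_mul_eq_one_left (xx_inv h hI (k+1) b a (by omega))
  have B12 : ∀ a b c, B a b c → B b a c := by
    intro a b c hB
    simp only [B] at hB ⊢
    rw [e1 a b, e2 a b, eq_mul_inv_iff_mul_eq, mul_assoc, mul_assoc, inv_mul_eq_iff_eq_mul,
      ← mul_assoc, ← mul_assoc, ← hB]
  have B23 : ∀ a b c, B a b c → B a c b := by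
    intro a b c hB
    simp only [B] at hB ⊢
    rw [e1 b c, e2 b c, mul_inv_eq_iff_eq_mul, mul_assoc, mul_assoc, eq_inv_mul_iff_mul_eq,
      ← mul_assoc, ← mul_assoc, ← hB]
  have c1 : ∀ a b c, ¬ I a b → ¬ I b a → ¬ I a c → ¬ I c a → ¬ I b c → ¬ I c b → B a b c := by
    intro a b c h1 h2 h3 h4 h5 h6; simp [B, xx, *]
  have c2 : ∀ a b c, I a b → ¬ I a c → ¬ I c a → ¬ I b c → ¬ I c b → B a b c := by
    intro a b c h1 h3 h4 h5 h6; simp [B, xx, *]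
  have c3 : ∀ a b c, I a b → I a c → I b c → B a b c := by
    intro a b c h1 h2 h3; simp [B, xx, *]
  have c4 : ∀ a b c, ¬ I a b → ¬ I b a → I a c → I b c → B a b c := by
    intro a b c h1 h2 h3 h4; simp [B, xx, *]
  show B a b c
  have as := hI.asymm
  have tr := hI.trans
  have fo := hI.forest
  by_cases i1 : I a b <;> by_cases i2 : I b a <;> by_cases i3 : I a c <;> by_cases i4 : I c a <;>
    by_cases i5 : I b c <;> by_cases i6 : I c b <;> grind

end Coherence

def pot {A : Type*} [Group A] (ρ σ : ℕ → A) {n : ℕ} (I : Fin n → Fin n → Prop)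
    (π : Equiv.Perm (Fin n)) : A := (potD (xx ρ σ I) 0 (List.ofFn π))⁻¹

theorem ofFn_split {α : Type*} {n : ℕ} (f : Fin n → α) (k : ℕ) (hk : k + 1 < n) :
    List.ofFn f = (List.ofFn f).take k ++ f ⟨k, by omega⟩ :: f ⟨k + 1, hk⟩ ::
      (List.ofFn f).drop (k + 2) := by
  conv_lhs => rw [← List.take_append_drop k (List.ofFn f)]
  rw [List.drop_eq_getElem_cons (by simp; omega), List.drop_eq_getElem_cons (by simp; omega)]
  simp

theorem ofFn_sw {n : ℕ} (π : Equiv.Perm (Fin n)) (k : ℕ) (hk : k + 1 < n) :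
    List.ofFn (π * sw k hk) = (List.ofFn π).take k ++ π ⟨k + 1, hk⟩ :: π ⟨k, by omega⟩ ::
      (List.ofFn π).drop (k + 2) := by
  rw [ofFn_split _ k hk]
  simp only [Equiv.Perm.mul_apply, sw_left, sw_right]
  congr 1
  · apply List.ext_getElem
    · simp
    · intro i h1 h2
      simp at h1
      simp [sw_ne k hk ⟨i, by omega⟩ (by simp; omega) (by simp; omega)]
  · congr 2
    apply List.ext_getElem
    · simp
    · intro i h1 h2
      simp at h1
      simp [sw_ne k hk ⟨k + 2 + i, by omega⟩ (by simp; omega) (by simp; omega)]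

section Coherence2
variable {A : Type*} [Group A] {n : ℕ} {ρ σ : ℕ → A} (h : Rels n ρ σ)
include h

theorem pot_sw {I : Fin n → Fin n → Prop} (hI : Forest I) (π : Equiv.Perm (Fin n)) (k : ℕ)
    (hk : k + 1 < n) :
    pot ρ σ I (π * sw k hk) = pot ρ σ I π * xx ρ σ I k (π ⟨k, by omega⟩) (π ⟨k + 1, hk⟩) := by
  have e := potD_swap (x := xx ρ σ I) (N := n) (fun k a b hk => xx_inv h hI k a b hk)
    (fun k l a b c d h1 h2 => xx_comm h k l a b c d h1 h2)
    (fun k a b c h1 h2 h3 h4 => xx_braid h hI k a b c h1 h2 h3 h4)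
    (π ⟨k, by omega⟩) (π ⟨k + 1, hk⟩) (fun hh => by
      have := congrArg Fin.val (π.injective hh); simp at this)
    ((List.ofFn π).drop (k + 2)) ((List.ofFn π).take k) 0 (by simp; omega)
  rw [← ofFn_sw, ← ofFn_split] at e
  have hl : 0 + ((List.ofFn π).take k).length = k := by simp; omega
  rw [hl] at e
  unfold pot
  rw [e]; group

theorem pot_indep {I I' : Fin n → Fin n → Prop} (hI : Forest I) (hI' : Forest I')
    (τ π π' : Equiv.Perm (Fin n))
    (hA : ∀ i j, i < j → π'⁻¹ (π j) < π'⁻¹ (π i) →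
      (I (π i) (π j) ↔ I' (τ (π i)) (τ (π j))) ∧ (I (π j) (π i) ↔ I' (τ (π j)) (τ (π i)))) :
    (pot ρ σ I π)⁻¹ * pot ρ σ I π' = (pot ρ σ I' (τ * π))⁻¹ * pot ρ σ I' (τ * π') := by
  refine gallery (fun a b => (I a b ↔ I' (τ a) (τ b)) ∧ (I b a ↔ I' (τ b) (τ a))) π'
    (fun π'' => (pot ρ σ I π)⁻¹ * pot ρ σ I π'' = (pot ρ σ I' (τ * π))⁻¹ * pot ρ σ I' (τ * π''))
    ?_ π hA (by simp)
  intro π1 k hk h1 h2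
  rw [pot_sw h hI, ← mul_assoc τ, pot_sw h hI', ← mul_assoc, h1, ← mul_assoc]
  congr 1
  exact xx_congr ρ σ k h2.1 h2.2

end Coherence2

/-! ### The presented group -/

abbrev GG (n : ℕ) := PresentedGroup (urRels n)

def pρ (n : ℕ) (k : ℕ) : GG n :=
  if h : k < n - 1 then PresentedGroup.of (Sum.inl ⟨k, h⟩) else 1
def pσ (n : ℕ) (k : ℕ) : GG n :=
  if h : k < n - 1 then PresentedGroup.of (Sum.inr ⟨k, h⟩) else 1

theorem mem_ur_comm {n : ℕ} (i j : Fin (n - 1))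
    (hij : (i : ℕ) + 2 ≤ (j : ℕ) ∨ (j : ℕ) + 2 ≤ (i : ℕ)) (g : FreeGroup (BrGen n))
    (hg : g = gρ i * gρ j * (gρ j * gρ i)⁻¹ ∨ g = gσ i * gσ j * (gσ j * gσ i)⁻¹ ∨
      g = gρ i * gσ j * (gσ j * gρ i)⁻¹) : g ∈ urRels n := by
  refine Or.inl (Or.inl ?_)
  simp only [Set.mem_iUnion]
  exact ⟨i, j, hij, hg⟩

theorem mem_ur_braid {n : ℕ} (i j : Fin (n - 1))
    (hij : (j : ℕ) = (i : ℕ) + 1) (g : FreeGroup (BrGen n))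
    (hg : g = gρ i * gρ j * gρ i * (gρ j * gρ i * gρ j)⁻¹ ∨
      g = gσ i * gσ j * gσ i * (gσ j * gσ i * gσ j)⁻¹ ∨
      g = gρ i * gσ j * gσ i * (gσ j * gσ i * gρ j)⁻¹ ∨
      g = gσ i * gσ j * gρ i * (gρ j * gσ i * gσ j)⁻¹ ∨
      g = gσ i * gρ j * gρ i * (gρ j * gρ i * gσ j)⁻¹) : g ∈ urRels n := by
  refine Or.inl (Or.inr ?_)
  simp only [Set.mem_iUnion]
  exact ⟨i, j, hij, hg⟩

theorem mem_ur_sq {n : ℕ} (i : Fin (n - 1)) : gσ i * gσ i ∈ urRels n := by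
  refine Or.inr ?_
  simp only [Set.mem_iUnion]
  exact ⟨i, rfl⟩

theorem rels_pres (n : ℕ) : Rels n (pρ n) (pσ n) := by
  have key : ∀ g ∈ urRels n, PresentedGroup.mk (urRels n) g = 1 := fun g hg =>
    PresentedGroup.one_of_mem hg
  have eρ : ∀ k (h : k < n - 1), pρ n k = PresentedGroup.mk (urRels n) (gρ ⟨k, h⟩) := by
    intro k h; simp [pρ, h, PresentedGroup.of, gρ]
  have eσ : ∀ k (h : k < n - 1), pσ n k = PresentedGroup.mk (urRels n) (gσ ⟨k, h⟩) := by
    intro k h; simp [pσ, h, PresentedGroup.of, gσ]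
  constructor
  · intro k l hkl hl
    have := key _ (mem_ur_comm ⟨k, by omega⟩ ⟨l, by omega⟩ (Or.inl hkl) _ (Or.inl rfl))
    rw [map_mul, map_inv, mul_inv_eq_one, map_mul, map_mul] at this
    rw [eρ k (by omega), eρ l (by omega)]; exact this
  · intro k l hkl hl
    have := key _ (mem_ur_comm ⟨k, by omega⟩ ⟨l, by omega⟩ (Or.inl hkl) _ (Or.inr (Or.inl rfl)))
    rw [map_mul, map_inv, mul_inv_eq_one, map_mul, map_mul] at this
    rw [eσ k (by omega), eσ l (by omega)]; exact this
  · intro k l hkl hl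
    have := key _ (mem_ur_comm ⟨k, by omega⟩ ⟨l, by omega⟩ (Or.inl hkl) _ (Or.inr (Or.inr rfl)))
    rw [map_mul, map_inv, mul_inv_eq_one, map_mul, map_mul] at this
    rw [eρ k (by omega), eσ l (by omega)]; exact this
  · intro k l hkl hl
    have := key _ (mem_ur_comm ⟨l, by omega⟩ ⟨k, by omega⟩ (Or.inr hkl) _ (Or.inr (Or.inr rfl)))
    rw [map_mul, map_inv, mul_inv_eq_one, map_mul, map_mul] at this
    rw [eσ k (by omega), eρ l (by omega)]; exact this.symm
  · intro k hk
    have := key _ (mem_ur_braid ⟨k, by omega⟩ ⟨k + 1, by omega⟩ rfl _ (Or.inl rfl))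
    rw [map_mul, map_inv, mul_inv_eq_one] at this
    simpa only [map_mul, ← eρ, ← eσ] using this
  · intro k hk
    have := key _ (mem_ur_braid ⟨k, by omega⟩ ⟨k + 1, by omega⟩ rfl _ (Or.inr (Or.inl rfl)))
    rw [map_mul, map_inv, mul_inv_eq_one] at this
    simpa only [map_mul, ← eρ, ← eσ] using this
  · intro k hk
    have := key _ (mem_ur_braid ⟨k, by omega⟩ ⟨k + 1, by omega⟩ rfl _
      (Or.inr (Or.inr (Or.inl rfl))))
    rw [map_mul, map_inv, mul_inv_eq_one] at this
    simpa only [map_mul, ← eρ, ← eσ] using this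
  · intro k hk
    have := key _ (mem_ur_braid ⟨k, by omega⟩ ⟨k + 1, by omega⟩ rfl _
      (Or.inr (Or.inr (Or.inr (Or.inl rfl)))))
    rw [map_mul, map_inv, mul_inv_eq_one] at this
    simpa only [map_mul, ← eρ, ← eσ] using this
  · intro k hk
    have := key _ (mem_ur_braid ⟨k, by omega⟩ ⟨k + 1, by omega⟩ rfl _
      (Or.inr (Or.inr (Or.inr (Or.inr rfl)))))
    rw [map_mul, map_inv, mul_inv_eq_one] at this
    simpa only [map_mul, ← eρ, ← eσ] using this
  · intro k hk
    have := key _ (mem_ur_sq ⟨k, by omega⟩)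
    simpa only [map_mul, ← eρ, ← eσ] using this

theorem exists_hom {A : Type*} [Group A] {n : ℕ} {ρ σ : ℕ → A} (h : Rels n ρ σ) :
    ∃ F : GG n →* A, (∀ k, k + 1 < n → F (pρ n k) = ρ k) ∧ ∀ k, k + 1 < n → F (pσ n k) = σ k := by
  let f : BrGen n → A := Sum.elim (fun i => ρ i) (fun i => σ i)
  have fρ : ∀ i : Fin (n - 1), FreeGroup.lift f (gρ i) = ρ i := by intro i; simp [gρ, f]
  have fσ : ∀ i : Fin (n - 1), FreeGroup.lift f (gσ i) = σ i := by intro i; simp [gσ, f]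
  have hf : ∀ r ∈ urRels n, FreeGroup.lift f r = 1 := by
    rintro r ((hr | hr) | hr)
    · simp only [Set.mem_iUnion] at hr
      obtain ⟨i, j, hij, hr⟩ := hr
      have := i.2
      have := j.2
      rcases hr with rfl | rfl | rfl <;>
        simp only [map_mul, map_inv, fρ, fσ, mul_inv_eq_one]
      · rcases hij with hij | hij
        · exact h.rr _ _ hij (by omega)
        · exact (h.rr _ _ hij (by omega)).symm
      · rcases hij with hij | hij
        · exact h.ss _ _ hij (by omega)
        · exact (h.ss _ _ hij (by omega)).symm
      · rcases hij with hij | hij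
        · exact h.rs _ _ hij (by omega)
        · exact (h.sr _ _ hij (by omega)).symm
    · simp only [Set.mem_iUnion] at hr
      obtain ⟨i, j, hij, hr⟩ := hr
      have := i.2
      have := j.2
      rcases hr with rfl | rfl | rfl | rfl | rfl <;>
        simp only [map_mul, map_inv, fρ, fσ, mul_inv_eq_one, hij]
      · exact h.b1 _ (by omega)
      · exact h.b2 _ (by omega)
      · exact h.b3 _ (by omega)
      · exact h.b4 _ (by omega)
      · exact h.b5 _ (by omega)
    · simp only [Set.mem_iUnion] at hr
      obtain ⟨i, rfl⟩ := hr
      have := i.2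
      simp only [map_mul, fσ]
      exact h.sq _ (by omega)
  refine ⟨PresentedGroup.toGroup hf, ?_, ?_⟩
  · intro k hk
    have : k < n - 1 := by omega
    simp [pρ, this, f]
  · intro k hk
    have : k < n - 1 := by omega
    simp [pσ, this, f]

theorem GG_closure (n : ℕ) (H : Subgroup (GG n)) (hρ : ∀ k, k + 1 < n → pρ n k ∈ H)
    (hσ : ∀ k, k + 1 < n → pσ n k ∈ H) : H = ⊤ := by
  rw [eq_top_iff, ← PresentedGroup.closure_range_of (urRels n), Subgroup.closure_le]
  rintro _ ⟨i | i, rfl⟩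
  · have := hρ i (by omega)
    simpa [pρ] using this
  · have := hσ i (by omega)
    simpa [pσ] using this

end URProof

namespace URProof

/-! ### The space of parameters -/

/-- position, center in the plane, radius -/
abbrev PP : Type := ℝ × ℂ × ℝ
abbrev VS (n : ℕ) : Type := Fin n → PP

def sepc (a b : PP) : Prop := a.2.2 + b.2.2 < ‖a.2.1 - b.2.1‖
def nst (a b : PP) : Prop := ‖a.2.1 - b.2.1‖ + a.2.2 < b.2.2

theorem sepc_symm {a b : PP} (h : sepc a b) : sepc b a := by
  unfold sepc at *; rw [norm_sub_rev]; linarith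

theorem nst_trans {a b c : PP} (h1 : nst a b) (h2 : nst b c) : nst a c := by
  unfold nst at *
  have := norm_sub_le_norm_sub_add_norm_sub a.2.1 b.2.1 c.2.1
  linarith

theorem nst_asymm {a b : PP} (h1 : nst a b) : ¬ nst b a := by
  unfold nst at *
  have h := norm_nonneg (a.2.1 - b.2.1)
  have h' := norm_nonneg (b.2.1 - a.2.1)
  intro h2
  linarith

theorem not_nst_of_sepc {a b : PP} (ha : 0 < a.2.2) (h : sepc a b) : ¬ nst a b := by
  unfold nst sepc at *
  intro h2
  linarith

def VV (n : ℕ) : Set (VS n) :=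
  {p | (∀ i, 0 < (p i).2.2) ∧ ∀ i j, i ≠ j → (p i).1 = (p j).1 →
    sepc (p i) (p j) ∨ nst (p i) (p j) ∨ nst (p j) (p i)}

theorem isOpen_sepc {n : ℕ} (i j : Fin n) : IsOpen {p : VS n | sepc (p i) (p j)} := by
  unfold sepc
  exact isOpen_lt (by fun_prop) (by fun_prop)

theorem isOpen_nst {n : ℕ} (i j : Fin n) : IsOpen {p : VS n | nst (p i) (p j)} := by
  unfold nst
  exact isOpen_lt (by fun_prop) (by fun_prop)

theorem isOpen_VV (n : ℕ) : IsOpen (VV n) := by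
  have : VV n = (⋂ i, {p : VS n | 0 < (p i).2.2}) ∩
      ⋂ i, ⋂ j, {p : VS n | i ≠ j → (p i).1 ≠ (p j).1 ∨
        sepc (p i) (p j) ∨ nst (p i) (p j) ∨ nst (p j) (p i)} := by
    ext p
    simp only [VV, Set.mem_ofPred_eq, Set.mem_inter_iff, Set.mem_iInter]
    refine and_congr_right fun _ => forall_congr' fun i => forall_congr' fun j =>
      forall_congr' fun _ => ?_
    tauto
  rw [this]
  refine IsOpen.inter (isOpen_iInter_of_finite fun i => isOpen_lt (by fun_prop) (by fun_prop))
    (isOpen_iInter_of_finite fun i => isOpen_iInter_of_finite fun j => ?_)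
  by_cases hij : i = j
  · simp [hij]
  · simp only [ne_eq, hij, not_false_eq_true, forall_const]
    refine IsOpen.union (isOpen_ne_fun (by fun_prop) (by fun_prop))
      (IsOpen.union (isOpen_sepc i j) (IsOpen.union (isOpen_nst i j) (isOpen_nst j i)))

theorem VV_inj {n : ℕ} {p : VS n} (hp : p ∈ VV n) : Function.Injective p := by
  intro i j hij
  by_contra hne
  have := hp.1 i
  rcases hp.2 i j hne (by rw [hij]) with h | h | h <;>
    simp [sepc, nst, hij] at h
  have := hp.1 j
  linarith

theorem VV_comp {n : ℕ} {p : VS n} (hp : p ∈ VV n) (τ : Equiv.Perm (Fin n)) : p ∘ τ ∈ VV n :=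
  ⟨fun i => hp.1 (τ i), fun i j hij hx => hp.2 (τ i) (τ j) (fun h => hij (τ.injective h)) hx⟩

theorem not_nst_self {n : ℕ} {p : VS n} (i : Fin n) : ¬ nst (p i) (p i) := by
  simp [nst]

/-- nesting relation at a configuration -/
def II {n : ℕ} (y : VS n) (a b : Fin n) : Prop := (y a).1 = (y b).1 ∧ nst (y a) (y b)

theorem forest_II {n : ℕ} {y : VS n} (hy : y ∈ VV n) : Forest (II y) where
  asymm a b h1 h2 := nst_asymm h1.2 h2.2
  trans a b c h1 h2 := ⟨h1.1.trans h2.1, nst_trans h1.2 h2.2⟩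
  forest a b c h1 h2 hbc := by
    have hx : (y b).1 = (y c).1 := h1.1.symm.trans h2.1
    rcases hy.2 b c hbc hx with h | h | h
    · exfalso
      have e1 := h1.2
      have e2 := h2.2
      have := hy.1 a
      unfold sepc nst at *
      have := norm_sub_le_norm_sub_add_norm_sub (y b).2.1 (y a).2.1 (y c).2.1
      rw [norm_sub_rev (y b).2.1 (y a).2.1] at this
      linarith
    · exact Or.inl ⟨hx, h⟩
    · exact Or.inr ⟨hx.symm, h⟩

/-- The conditions on chart radius -/
structure IsChart {n : ℕ} (y : VS n) (ε : ℝ) : Prop where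
  pos : 0 < ε
  sub : Metric.ball y ε ⊆ VV n
  lt : ∀ p ∈ Metric.ball y ε, ∀ i j, (y i).1 < (y j).1 → (p i).1 < (p j).1
  nst_iff : ∀ p ∈ Metric.ball y ε, ∀ i j, (y i).1 = (y j).1 → (nst (p i) (p j) ↔ nst (y i) (y j))
  uniq : ∀ p ∈ Metric.ball y ε, ∀ τ : Equiv.Perm (Fin n), p ∘ τ ∈ Metric.ball y ε → τ = 1

theorem exists_chart {n : ℕ} {y : VS n} (hy : y ∈ VV n) : ∃ ε, IsChart y ε := by
  have h1 : ∀ᶠ p in nhds y, p ∈ VV n := (isOpen_VV n).mem_nhds hy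
  have h2 : ∀ᶠ p in nhds y, ∀ i j, (y i).1 < (y j).1 → (p i).1 < (p j).1 := by
    refine Filter.eventually_all.2 fun i => Filter.eventually_all.2 fun j => ?_
    by_cases h : (y i).1 < (y j).1
    · have : IsOpen {p : VS n | (p i).1 < (p j).1} := isOpen_lt (by fun_prop) (by fun_prop)
      filter_upwards [this.mem_nhds h] with p hp _ using hp
    · exact Filter.Eventually.of_forall fun p hp => absurd hp h
  have h3 : ∀ᶠ p in nhds y, ∀ i j, (y i).1 = (y j).1 → (nst (p i) (p j) ↔ nst (y i) (y j)) := by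
    refine Filter.eventually_all.2 fun i => Filter.eventually_all.2 fun j => ?_
    by_cases hx : (y i).1 = (y j).1
    · by_cases hij : i = j
      · subst hij
        exact Filter.Eventually.of_forall fun p hp => by simp [nst]
      rcases hy.2 i j hij hx with h | h | h
      · filter_upwards [(isOpen_sepc i j).mem_nhds h, h1] with p hp hp1 _
        exact iff_of_false (not_nst_of_sepc (hp1.1 i) hp) (not_nst_of_sepc (hy.1 i) h)
      · filter_upwards [(isOpen_nst i j).mem_nhds h] with p hp _
        exact iff_of_true hp h
      · filter_upwards [(isOpen_nst j i).mem_nhds h] with p hp _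
        exact iff_of_false (nst_asymm hp) (nst_asymm h)
    · exact Filter.Eventually.of_forall fun p hp => absurd hp hx
  have h4 : ∀ᶠ ε in nhdsWithin (0:ℝ) (Set.Ioi 0), ∀ i j, i ≠ j → 2 * ε < dist (y i) (y j) := by
    refine Filter.eventually_all.2 fun i => Filter.eventually_all.2 fun j => ?_
    by_cases hij : i = j
    · simp [hij]
    have hd : 0 < dist (y i) (y j) := dist_pos.2 fun h => hij (VV_inj hy h)
    have : Set.Iio (dist (y i) (y j) / 2) ∈ nhds (0:ℝ) := Iio_mem_nhds (by linarith)
    filter_upwards [mem_nhdsWithin_of_mem_nhds this] with ε hε _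
    have : ε < dist (y i) (y j) / 2 := hε
    linarith
  obtain ⟨ε1, hε1, hb⟩ := Metric.eventually_nhds_iff_ball.1 (h1.and (h2.and h3))
  obtain ⟨ε, ⟨h4, hle⟩, hpos⟩ := ((h4.and (mem_nhdsWithin_of_mem_nhds (Iio_mem_nhds hε1))).and
    self_mem_nhdsWithin).exists
  have hle : ε < ε1 := hle
  have hsub := Metric.ball_subset_ball (x := y) hle.le
  refine ⟨ε, hpos, fun p hp => (hb p (hsub hp)).1, fun p hp => (hb p (hsub hp)).2.1,
    fun p hp => (hb p (hsub hp)).2.2, ?_⟩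
  intro p hp τ hτ
  ext1 i
  by_contra hne
  have h5 := h4 _ _ hne
  have e1 : dist (p (τ i)) (y (τ i)) < ε := (dist_le_pi_dist p y (τ i)).trans_lt hp
  have e2 : dist (p (τ i)) (y i) < ε := (dist_le_pi_dist (p ∘ τ) y i).trans_lt hτ
  have := dist_triangle_left (y (τ i)) (y i) (p (τ i))
  simp at h5
  linarith

def rad {n : ℕ} (y : VV n) : ℝ := (exists_chart y.2).choose
theorem rad_spec {n : ℕ} (y : VV n) : IsChart y.1 (rad y) := (exists_chart y.2).choose_spec
/-- chart ball -/
def CB {n : ℕ} (y : VV n) : Set (VS n) := Metric.ball y.1 (rad y)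

theorem isOpen_CB {n : ℕ} (y : VV n) : IsOpen (CB y) := Metric.isOpen_ball
theorem self_mem_CB {n : ℕ} (y : VV n) : y.1 ∈ CB y := Metric.mem_ball_self (rad_spec y).pos
theorem convex_CB {n : ℕ} (y : VV n) : Convex ℝ (CB y) := convex_ball _ _

/-- configurations in sorted order -/
def Mo (n : ℕ) : Set (VS n) := {w | w ∈ VV n ∧ Monotone fun i => (w i).1}

open Classical in
/-- the permutation comparing `w` to the chart at `y` -/
def cperm {n : ℕ} (y : VV n) (w : VS n) : Equiv.Perm (Fin n) :=
  if h : ∃ π : Equiv.Perm (Fin n), w ∘ π.symm ∈ CB y then h.choose else 1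

theorem comp_cancel {n : ℕ} (a : VS n) (π : Equiv.Perm (Fin n)) : (a ∘ π) ∘ π.symm = a := by
  ext1 i; simp

theorem cperm_eq {n : ℕ} {y : VV n} {a : VS n} (ha : a ∈ CB y) (π : Equiv.Perm (Fin n)) :
    cperm y (a ∘ π) = π := by
  have h : ∃ π' : Equiv.Perm (Fin n), (a ∘ π) ∘ π'.symm ∈ CB y := ⟨π, by rwa [comp_cancel]⟩
  have h2 := h.choose_spec
  rw [cperm, dif_pos h]
  set π' := h.choose
  have h3 := (rad_spec y).uniq a ha (π * π'⁻¹) h2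
  exact (mul_inv_eq_one.1 h3).symm

/-- chart value -/
def TT {n : ℕ} (y : VV n) (w : VS n) : GG n := pot (pρ n) (pσ n) (II y.1) (cperm y w)

theorem TT_eq {n : ℕ} {y : VV n} {a : VS n} (ha : a ∈ CB y) (π : Equiv.Perm (Fin n)) :
    TT y (a ∘ π) = pot (pρ n) (pσ n) (II y.1) π := by rw [TT, cperm_eq ha]

theorem tie {n : ℕ} {y : VV n} {a a' : VS n} (ha : a ∈ CB y) (ha' : a' ∈ CB y) (A B : Fin n)
    (h1 : (a A).1 ≤ (a B).1) (h2 : (a' B).1 ≤ (a' A).1) : (y.1 A).1 = (y.1 B).1 := by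
  rcases lt_trichotomy (y.1 A).1 (y.1 B).1 with h | h | h
  · exact absurd ((rad_spec y).lt a' ha' _ _ h) h2.not_gt
  · exact h
  · exact absurd ((rad_spec y).lt a ha _ _ h) h1.not_gt

theorem II_iff {n : ℕ} {y : VV n} {a : VS n} (ha : a ∈ CB y) (A B : Fin n)
    (h : (y.1 A).1 = (y.1 B).1) : II y.1 A B ↔ nst (a A) (a B) := by
  rw [(rad_spec y).nst_iff a ha A B h]
  exact and_iff_right h

theorem trans_const {n : ℕ} {y z : VV n} {a a' : VS n} (τ π π' : Equiv.Perm (Fin n))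
    (ha : a ∈ CB y) (ha' : a' ∈ CB y) (hz : a ∘ τ ∈ CB z) (hz' : a' ∘ τ ∈ CB z)
    (hm : a ∘ π ∈ Mo n) (hm' : a' ∘ π' ∈ Mo n) :
    TT z (a ∘ π) * (TT y (a ∘ π))⁻¹ = TT z (a' ∘ π') * (TT y (a' ∘ π'))⁻¹ := by
  have e : ∀ (a : VS n) (π : Equiv.Perm (Fin n)), a ∘ π = (a ∘ τ) ∘ (τ⁻¹ * π) := by
    intro a π; ext1 i; simp
  rw [TT_eq ha, TT_eq ha']
  rw [e a, e a', TT_eq hz, TT_eq hz']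
  have := pot_indep (rels_pres n) (forest_II y.2) (forest_II z.2) τ⁻¹ π π' ?_
  · rw [inv_mul_eq_iff_eq_mul] at this
    rw [this]; group
  · intro i j hij hinv
    have x1 : (a (π i)).1 ≤ (a (π j)).1 := hm.2 hij.le
    have x2 : (a' (π j)).1 ≤ (a' (π i)).1 := by
      have := hm'.2 hinv.le
      simpa using this
    have ty := tie ha ha' _ _ x1 x2
    have tz := tie (y := z) hz hz' (τ⁻¹ (π i)) (τ⁻¹ (π j)) (by simpa using x1) (by simpa using x2)
    rw [II_iff ha _ _ ty, II_iff hz _ _ tz, II_iff ha _ _ ty.symm, II_iff hz _ _ tz.symm]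
    simp

theorem TT_sw {n : ℕ} {y : VV n} {a : VS n} (ha : a ∈ CB y) (π : Equiv.Perm (Fin n))
    (k : ℕ) (hk : k + 1 < n) (hm : a ∘ π ∈ Mo n) (hm' : (a ∘ π) ∘ sw k hk ∈ Mo n) :
    TT y ((a ∘ π) ∘ sw k hk) = TT y (a ∘ π) *
      xx (pρ n) (pσ n) (fun i j => nst ((a ∘ π) i) ((a ∘ π) j)) k ⟨k, by omega⟩ ⟨k + 1, hk⟩ := by
  have e : (a ∘ π) ∘ sw k hk = a ∘ (π * sw k hk) := rfl
  rw [e, TT_eq ha, TT_eq ha, pot_sw (rels_pres n) (forest_II y.2)]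
  congr 1
  have x1 : (a (π ⟨k, by omega⟩)).1 ≤ (a (π ⟨k + 1, hk⟩)).1 := hm.2 (by simp [Fin.le_def])
  have x2 : (a (π ⟨k + 1, hk⟩)).1 ≤ (a (π ⟨k, by omega⟩)).1 := by
    have : (((a ∘ π) ∘ sw k hk) ⟨k, by omega⟩).1 ≤ (((a ∘ π) ∘ sw k hk) ⟨k + 1, hk⟩).1 :=
      hm'.2 (by simp [Fin.le_def])
    simpa [sw_left, sw_right] using this
  have ty := tie ha ha _ _ x1 x2
  apply xx_congr
  · rw [II_iff ha _ _ ty]; rfl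
  · rw [II_iff ha _ _ ty.symm]; rfl

end URProof

namespace URProof

/-- `q` exhibits `X` as the quotient of the parameter space by permutations -/
structure Quo {n : ℕ} {X : Type} [TopologicalSpace X] (q : VV n → X) : Prop where
  cont : Continuous q
  opn : IsOpenMap q
  surj : Function.Surjective q
  eq_iff : ∀ p p' : VV n, q p = q p' ↔ ∃ τ : Equiv.Perm (Fin n), p'.1 = p.1 ∘ τ

theorem exists_sort {n : ℕ} (p : VS n) : ∃ τ : Equiv.Perm (Fin n), Monotone fun i => ((p ∘ τ) i).1 :=
  ⟨Tuple.sort fun i => (p i).1, Tuple.monotone_sort fun i => (p i).1⟩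

def jj {n : ℕ} {X : Type} (q : VV n → X) (w : Mo n) : X := q ⟨w.1, w.2.1⟩

section
variable {n : ℕ} {X : Type} [TopologicalSpace X] {q : VV n → X} (hq : Quo q)
include hq

theorem jj_surj : Function.Surjective (jj q) := by
  intro b
  obtain ⟨p, rfl⟩ := hq.surj b
  obtain ⟨τ, hτ⟩ := exists_sort p.1
  exact ⟨⟨p.1 ∘ τ, VV_comp p.2 τ, hτ⟩, ((hq.eq_iff _ _).2 ⟨τ, rfl⟩).symm⟩

theorem jj_cont : Continuous (jj q) := by
  unfold jj
  exact hq.cont.comp (by fun_prop)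

def lft (b : X) : Mo n := (jj_surj hq b).choose
theorem lft_spec (b : X) : jj q (lft hq b) = b := (jj_surj hq b).choose_spec

/-- base sets -/
def bs (_ : Quo q) (y : VV n) : Set X := q '' {p | p.1 ∈ CB y}

theorem mem_bs {y : VV n} {w : Mo n} (h : jj q w ∈ bs hq y) :
    ∃ a ∈ CB y, ∃ π : Equiv.Perm (Fin n), w.1 = a ∘ π := by
  obtain ⟨p, hp, hpw⟩ := h
  obtain ⟨τ, hτ⟩ := (hq.eq_iff _ _).1 hpw
  exact ⟨p.1, hp, τ, hτ⟩

theorem isOpen_bs (y : VV n) : IsOpen (bs hq y) :=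
  hq.opn _ ((isOpen_CB y).preimage continuous_subtype_val)

theorem same_fiber {y z : VV n} {w w' : Mo n} (hw : jj q w = jj q w')
    (hy : jj q w ∈ bs hq y) (hz : jj q w ∈ bs hq z) :
    TT z w.1 * (TT y w.1)⁻¹ = TT z w'.1 * (TT y w'.1)⁻¹ := by
  obtain ⟨a, ha, π, hπ⟩ := mem_bs hq hy
  obtain ⟨a', ha', π', hπ'⟩ := mem_bs hq hz
  obtain ⟨τ, hτ⟩ := (hq.eq_iff _ _).1 hw
  have hτ : w'.1 = w.1 ∘ τ := hτ
  have e : w'.1 = a ∘ (π * τ) := by rw [hτ, hπ]; rfl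
  have e2 : a' = a ∘ (π * π'⁻¹) := by
    have := congrArg (fun f => f ∘ π'.symm) (hπ.symm.trans hπ')
    simp only [comp_cancel] at this
    exact this.symm
  have hm := w.2
  have hm' := w'.2
  rw [hπ] at hm ⊢
  rw [e] at hm' ⊢
  exact trans_const (π * π'⁻¹) _ _ ha ha (e2 ▸ ha') (e2 ▸ ha') hm hm'

def core [TopologicalSpace (GG n)] [DiscreteTopology (GG n)] :
    FiberBundleCore (VV n) X (GG n) where
  baseSet := bs hq
  isOpen_baseSet := isOpen_bs hq
  indexAt b := ⟨(lft hq b).1, (lft hq b).2.1⟩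
  mem_baseSet_at b := ⟨⟨(lft hq b).1, (lft hq b).2.1⟩, self_mem_CB _, lft_spec hq b⟩
  coordChange y z b g := TT z (lft hq b).1 * (TT y (lft hq b).1)⁻¹ * g
  coordChange_self y b _ g := by simp
  coordChange_comp y z u b _ g := by group
  continuousOn_coordChange y z := by
    rintro ⟨b, g⟩ ⟨⟨hy, hz⟩, -⟩
    refine ContinuousAt.continuousWithinAt ?_
    simp only at hy hz
    obtain ⟨a, ha, hab⟩ := hy
    obtain ⟨a', ha', hab'⟩ := hz
    obtain ⟨τ, hτ⟩ := (hq.eq_iff _ _).1 (hab.trans hab'.symm)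
    let O : Set (VV n) := {p | p.1 ∈ CB y ∧ p.1 ∘ τ ∈ CB z}
    have hO : IsOpen O := by
      refine IsOpen.inter ((isOpen_CB y).preimage continuous_subtype_val)
        ((isOpen_CB z).preimage ?_)
      exact continuous_pi fun i => (continuous_apply (τ i)).comp continuous_subtype_val
    have haO : a ∈ O := ⟨ha, by rw [← hτ]; exact ha'⟩
    have hqO : q '' O ∈ nhds b := (hq.opn _ hO).mem_nhds ⟨a, haO, hab⟩
    have key : ∀ b' ∈ q '' O, TT z (lft hq b').1 * (TT y (lft hq b').1)⁻¹ =
        TT z (lft hq b).1 * (TT y (lft hq b).1)⁻¹ := by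
      rintro b' ⟨c, hc, rfl⟩
      have e1 := lft_spec hq (q c)
      have e2 := lft_spec hq b
      obtain ⟨π, hπ⟩ := (hq.eq_iff _ _).1 e1.symm
      obtain ⟨π', hπ'⟩ := (hq.eq_iff _ _).1 (hab.trans e2.symm)
      have hm := (lft hq (q c)).2
      have hm' := (lft hq b).2
      simp only at hπ hπ'
      rw [hπ] at hm ⊢
      rw [hπ'] at hm' ⊢
      exact trans_const τ _ _ hc.1 ha hc.2 haO.2 hm hm'
    have : (fun p : X × GG n => TT z (lft hq p.1).1 * (TT y (lft hq p.1).1)⁻¹ * p.2) =ᶠ[nhds (b, g)]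
        fun p => (TT z (lft hq b).1 * (TT y (lft hq b).1)⁻¹) * p.2 := by
      have h2 : Prod.fst ⁻¹' (q '' O) ∈ nhds (b, g) := continuous_fst.continuousAt hqO
      filter_upwards [h2] with p hp
      rw [key _ hp]
    refine ContinuousAt.congr ?_ this.symm
    exact ((continuous_of_discreteTopology (f := fun g : GG n =>
      (TT z (lft hq b).1 * (TT y (lft hq b).1)⁻¹) * g)).comp continuous_snd).continuousAt

theorem exists_cover : ∃ (E : Type) (_ : TopologicalSpace E) (p : E → X) (_ : IsCoveringMap p)
    (e : Mo n → GG n → E), (∀ g, Continuous fun w => e w g) ∧ (∀ w g, p (e w g) = jj q w) ∧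
    (∀ w g g', e w g = e w g' → g = g') ∧
    (∀ (w w' : Mo n) k (hk : k + 1 < n) g, w'.1 = w.1 ∘ sw k hk → e w' g =
      e w (xx (pρ n) (pσ n) (fun i j => nst (w.1 i) (w.1 j)) k ⟨k, by omega⟩ ⟨k + 1, hk⟩ * g)) := by
  let _ : TopologicalSpace (GG n) := ⊥
  have _ : DiscreteTopology (GG n) := ⟨rfl⟩
  let Z := core hq
  let e : Mo n → GG n → Z.TotalSpace := fun w g => ⟨jj q w, TT (Z.indexAt (jj q w)) w.1 * g⟩
  have hproj : ∀ w g, (e w g).proj = jj q w := fun w g => rfl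
  have hchart : ∀ y (w : Mo n) g, jj q w ∈ bs hq y →
      Z.localTriv y (e w g) = (jj q w, TT y w.1 * g) := by
    intro y w g hy
    rw [Z.localTriv_apply]
    refine Prod.ext rfl ?_
    change TT y (lft hq (jj q w)).1 * (TT (Z.indexAt (jj q w)) (lft hq (jj q w)).1)⁻¹ *
      (TT (Z.indexAt (jj q w)) w.1 * g) = _
    rw [← same_fiber hq (w := w) (w' := lft hq (jj q w)) (lft_spec hq _).symm
      (Z.mem_baseSet_at (jj q w)) hy]
    group
  refine ⟨Z.TotalSpace, inferInstance, Z.proj, FiberBundle.isCoveringMap, e, ?_, hproj, ?_, ?_⟩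
  · intro g
    rw [continuous_iff_continuousAt]
    intro w
    have hy := Z.mem_baseSet_at (jj q w)
    set y := Z.indexAt (jj q w) with hydef
    have hsrc : e w g ∈ (Z.localTriv y).source := (Z.mem_localTriv_source y _).2 hy
    have hnear : ∀ᶠ w' in nhds w, jj q w' ∈ bs hq y :=
      (jj_cont hq).continuousAt ((isOpen_bs hq y).mem_nhds hy)
    rw [(Z.localTriv y).toOpenPartialHomeomorph.continuousAt_iff_continuousAt_comp_left
      (f := fun w => e w g)]
    · obtain ⟨a, ha, π, hπ⟩ := mem_bs hq hy
      have hcon : Continuous fun w' : Mo n => w'.1 ∘ π.symm :=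
        continuous_pi fun i => (continuous_apply (π.symm i)).comp continuous_subtype_val
      have h2 : ∀ᶠ w' in nhds w, w'.1 ∘ π.symm ∈ CB y := by
        refine hcon.continuousAt ((isOpen_CB y).mem_nhds ?_)
        rw [hπ, comp_cancel]; exact ha
      have : (fun w' => (jj q w', pot (pρ n) (pσ n) (II y.1) π * g)) =ᶠ[nhds w]
          (Z.localTriv y) ∘ (fun w => e w g) := by
        filter_upwards [hnear, h2] with w' h3 h4
        simp only [Function.comp_apply]
        rw [hchart y w' g h3, ← TT_eq h4]
        congr 3
        ext1 i; simp
      refine ContinuousAt.congr ?_ this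
      exact ((jj_cont hq).prodMk continuous_const).continuousAt
    · filter_upwards [hnear] with w' hw'
      exact (Z.mem_localTriv_source y _).2 hw'
  · intro w g g' h
    have hy := Z.mem_baseSet_at (jj q w)
    have := congrArg (fun t => (Z.localTriv (Z.indexAt (jj q w)) t).2) h
    simp only [hchart _ w _ hy] at this
    exact mul_left_cancel this
  · intro w w' k hk g hw
    have hj : jj q w' = jj q w := ((hq.eq_iff _ _).2 ⟨sw k hk, hw⟩).symm
    have hy := Z.mem_baseSet_at (jj q w)
    set y := Z.indexAt (jj q w)
    apply (Z.localTriv y).injOn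
    · exact (Z.mem_localTriv_source y _).2 (by rw [hproj, hj]; exact hy)
    · exact (Z.mem_localTriv_source y _).2 hy
    · change Z.localTriv y _ = Z.localTriv y _
      rw [hchart y w _ hy, hchart y w' _ (by rw [hj]; exact hy), hj]
      obtain ⟨a, ha, π, hπ⟩ := mem_bs hq hy
      have hm := w.2
      have hm' := w'.2
      rw [hw] at hm' ⊢
      rw [hπ] at hm hm' ⊢
      rw [TT_sw ha π k hk hm hm', mul_assoc]
end
end URProof

namespace URProof

/-! ### Groupoid laws for homotopy classes -/
section
variable {X : Type} [TopologicalSpace X] {a b c d : X}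
abbrev HQ (a b : X) := Path.Homotopic.Quotient a b

theorem hq_assoc (p : HQ a b) (q : HQ b c) (r : HQ c d) :
    (p.trans q).trans r = p.trans (q.trans r) :=
  Category.assoc (obj := FundamentalGroupoid X) (W := ⟨a⟩) (X := ⟨b⟩) (Y := ⟨c⟩) (Z := ⟨d⟩) p q r
theorem hq_refl_trans (p : HQ a b) : (Path.Homotopic.Quotient.refl a).trans p = p :=
  Category.id_comp (obj := FundamentalGroupoid X) (X := ⟨a⟩) (Y := ⟨b⟩) p
theorem hq_trans_refl (p : HQ a b) : p.trans (Path.Homotopic.Quotient.refl b) = p :=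
  Category.comp_id (obj := FundamentalGroupoid X) (X := ⟨a⟩) (Y := ⟨b⟩) p
theorem hq_trans_symm (p : HQ a b) : p.trans p.symm = Path.Homotopic.Quotient.refl a :=
  Groupoid.comp_inv (obj := FundamentalGroupoid X) (X := ⟨a⟩) (Y := ⟨b⟩) p
theorem hq_symm_trans (p : HQ a b) : p.symm.trans p = Path.Homotopic.Quotient.refl b :=
  Groupoid.inv_comp (obj := FundamentalGroupoid X) (X := ⟨a⟩) (Y := ⟨b⟩) p
theorem hq_trans_symm_assoc (p : HQ a b) (q : HQ a c) : p.trans (p.symm.trans q) = q := by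
  rw [← hq_assoc, hq_trans_symm, hq_refl_trans]
theorem hq_symm_trans_assoc (p : HQ a b) (q : HQ b c) : p.symm.trans (p.trans q) = q := by
  rw [← hq_assoc, hq_symm_trans, hq_refl_trans]
theorem hq_symm_of_trans (p : HQ a b) (q : HQ b c) : (p.trans q).symm = q.symm.trans p.symm := by
  have h : (p.trans q).trans (q.symm.trans p.symm) = Path.Homotopic.Quotient.refl a := by
    rw [hq_assoc, hq_trans_symm_assoc, hq_trans_symm]
  rw [← hq_symm_trans_assoc (p.trans q) (q.symm.trans p.symm), h, hq_trans_refl]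
end

/-! ### Configurations -/

def cfg (n : ℕ) (ξ : ℕ → ℕ) (g : ℕ → ℂ × ℝ) : VS n := fun i => ((ξ i : ℝ), g i)

theorem VV_of_lt {n : ℕ} {p : VS n} (h0 : ∀ i, 0 < (p i).2.2)
    (h : ∀ i j, i < j → (p i).1 = (p j).1 →
      sepc (p i) (p j) ∨ nst (p i) (p j) ∨ nst (p j) (p i)) : p ∈ VV n := by
  refine ⟨h0, fun i j hij hx => ?_⟩
  rcases lt_or_gt_of_ne hij with h1 | h1
  · exact h i j h1 hx
  · rcases h j i h1 hx.symm with h | h | h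
    · exact Or.inl (sepc_symm h)
    · exact Or.inr (Or.inr h)
    · exact Or.inr (Or.inl h)

theorem cfg_mem (n : ℕ) (ξ : ℕ → ℕ) (g : ℕ → ℂ × ℝ) (h0 : ∀ i, 0 < (g i).2) (hξ : Monotone ξ)
    (h : ∀ i j : ℕ, i < j → ξ i = ξ j → sepc (0, g i) (0, g j) ∨ nst (0, g i) (0, g j) ∨
      nst (0, g j) (0, g i)) : cfg n ξ g ∈ Mo n := by
  refine ⟨VV_of_lt (fun i => h0 i) fun i j hij hx => ?_, fun i j hij => ?_⟩
  · exact h i j hij (Nat.cast_injective hx)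
  · exact Nat.cast_le.2 (hξ hij)

/-- base configuration -/
def w0 (n : ℕ) : Mo n := ⟨cfg n id fun _ => (0, 1), cfg_mem n _ _ (by simp) monotone_id
  fun i j hij h => absurd h hij.ne⟩

/-- convex combination -/
def sg {n : ℕ} (a b : VS n) (t : ℝ) : VS n := (1 - t) • a + t • b

theorem sg_fst {n : ℕ} (a b : VS n) (t : ℝ) (i : Fin n) :
    (sg a b t i).1 = (1 - t) * (a i).1 + t * (b i).1 := by simp [sg]
theorem sg_c {n : ℕ} (a b : VS n) (t : ℝ) (i : Fin n) :
    (sg a b t i).2.1 = (1 - t) • (a i).2.1 + t • (b i).2.1 := by simp [sg]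
theorem sg_r {n : ℕ} (a b : VS n) (t : ℝ) (i : Fin n) :
    (sg a b t i).2.2 = (1 - t) * (a i).2.2 + t * (b i).2.2 := by simp [sg]
theorem sg_zero {n : ℕ} (a b : VS n) : sg a b 0 = a := by simp [sg]
theorem sg_one {n : ℕ} (a b : VS n) : sg a b 1 = b := by simp [sg]
theorem sg_comp {n : ℕ} (a b : VS n) (t : ℝ) (τ : Equiv.Perm (Fin n)) :
    sg a b t ∘ τ = sg (a ∘ τ) (b ∘ τ) t := rfl
theorem sg_cont {n : ℕ} (a b : VS n) : Continuous (sg a b) := by unfold sg; fun_prop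

def SegIn {n : ℕ} (S : Set (VS n)) (a b : VS n) : Prop := ∀ t ∈ Set.Icc (0:ℝ) 1, sg a b t ∈ S

theorem sg_mono {n : ℕ} {a b : VS n} (ha : a ∈ Mo n) (hb : b ∈ Mo n) {t : ℝ}
    (ht : t ∈ Set.Icc (0:ℝ) 1) : Monotone fun i => (sg a b t i).1 := by
  intro i j hij
  have h1 : (a i).1 ≤ (a j).1 := ha.2 hij
  have h2 : (b i).1 ≤ (b j).1 := hb.2 hij
  simp only [sg_fst]
  have := ht.1
  have h3 : 0 ≤ 1 - t := by linarith [ht.2]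
  gcongr

theorem sg_pos {n : ℕ} {a b : VS n} (ha : a ∈ VV n) (hb : b ∈ VV n) {t : ℝ}
    (ht : t ∈ Set.Icc (0:ℝ) 1) (i : Fin n) : 0 < (sg a b t i).2.2 := by
  rw [sg_r]
  have h1 := ha.1 i
  have h2 := hb.1 i
  rcases eq_or_lt_of_le ht.1 with h | h
  · rw [← h]; simpa using h1
  · have : 0 ≤ 1 - t := by linarith [ht.2]
    positivity

/-- segments from configurations with few ties -/
theorem seg_ref {n : ℕ} {w w' : VS n} (hw : w ∈ Mo n) (hw' : w' ∈ Mo n)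
    (h : ∀ i j, i < j → (w i).1 = (w j).1 → ∀ t ∈ Set.Icc (0:ℝ) 1,
      sepc (sg w w' t i) (sg w w' t j) ∨ nst (sg w w' t i) (sg w w' t j) ∨
      nst (sg w w' t j) (sg w w' t i)) : SegIn (VV n) w w' := by
  intro t ht
  rcases eq_or_lt_of_le ht.2 with h1 | h1
  · rw [h1, sg_one]; exact hw'.1
  refine VV_of_lt (sg_pos hw.1 hw'.1 ht) fun i j hij hx => ?_
  refine h i j hij ?_ t ht
  have e1 : (w i).1 ≤ (w j).1 := hw.2 hij.le
  have e2 : (w' i).1 ≤ (w' j).1 := hw'.2 hij.le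
  rw [sg_fst, sg_fst] at hx
  by_contra hne
  have e3 : (w i).1 < (w j).1 := lt_of_le_of_ne e1 hne
  have := mul_lt_mul_of_pos_left e3 (sub_pos.2 h1)
  have := mul_le_mul_of_nonneg_left e2 ht.1
  linarith

theorem seg_mo {n : ℕ} {w w' : VS n} (hw : w ∈ Mo n) (hw' : w' ∈ Mo n)
    (h : SegIn (VV n) w w') : SegIn (Mo n) w w' :=
  fun t ht => ⟨h t ht, sg_mono hw hw' ht⟩

theorem star_mo (n : ℕ) : StarConvex ℝ (w0 n).1 (Mo n) := by
  intro w hw s t hs ht hst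
  have : SegIn (VV n) (w0 n).1 w := seg_ref (w0 n).2 hw fun i j hij hx => by
    exact absurd (Fin.ext (Nat.cast_injective hx)) hij.ne
  have h2 := seg_mo (w0 n).2 hw this t ⟨ht, by linarith⟩
  rwa [sg, ← hst, add_sub_cancel_right] at h2

instance (n : ℕ) : ContractibleSpace (Mo n) := (star_mo n).contractibleSpace ⟨_, (w0 n).2⟩

def segP {n : ℕ} {S : Set (VS n)} (a b : S) (h : SegIn S a.1 b.1) : Path a b where
  toFun t := ⟨sg a.1 b.1 t, h t t.2⟩
  continuous_toFun := Continuous.subtype_mk ((sg_cont _ _).comp continuous_subtype_val) _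
  source' := Subtype.ext (by simp [sg_zero])
  target' := Subtype.ext (by simp [sg_one])

section
variable {n : ℕ} {X : Type} [TopologicalSpace X] {q : VV n → X} (hq : Quo q)

/-- canonical class of paths from the base point -/
def Th (w : Mo n) (x : X) (h : jj q w = x) : HQ (jj q (w0 n)) x :=
  Path.Homotopic.Quotient.mk
    (((PathConnectedSpace.somePath (w0 n) w).map (jj_cont hq)).cast rfl h.symm)

theorem Th_eq (w : Mo n) (x : X) (h : jj q w = x) (δ : Path (w0 n) w) :
    Th hq w x h = Path.Homotopic.Quotient.mk ((δ.map (jj_cont hq)).cast rfl h.symm) := by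
  subst h
  have : (PathConnectedSpace.somePath (w0 n) w).Homotopic δ :=
    Path.Homotopic.Quotient.eq.1 (Subsingleton.elim _ _)
  exact Path.Homotopic.Quotient.eq.2 (this.map ⟨jj q, jj_cont hq⟩)

theorem Th_trans (w w' : Mo n) (γ : Path w w') (x x' : X) (h : jj q w = x) (h' : jj q w' = x')
    (c : Path x x') (hc : ∀ t, c t = jj q (γ t)) :
    (Th hq w x h).trans (Path.Homotopic.Quotient.mk c) = Th hq w' x' h' := by
  subst h h'
  have : c = γ.map (jj_cont hq) := Path.ext (funext hc)
  subst this
  rw [Th_eq hq w' _ rfl ((PathConnectedSpace.somePath (w0 n) w).trans γ)]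
  unfold Th
  rw [← Path.Homotopic.Quotient.mk_trans]
  congr 1
  exact (Path.map_trans _ _ _).symm

/-- image of a segment -/
def sq (a a' : VV n) (hs : SegIn (VV n) a.1 a'.1) : Path (q a) (q a') := (segP a a' hs).map hq.cont

theorem segS (a a' : VV n) (hs : SegIn (VV n) a.1 a'.1) (w w' : Mo n) (π : Equiv.Perm (Fin n))
    (hw : w.1 = a.1 ∘ π) (hw' : w'.1 = a'.1 ∘ π) (x x' : X) (hx : q a = x) (hx' : q a' = x')
    (h : jj q w = x) (h' : jj q w' = x') :
    (Th hq w x h).trans (Path.Homotopic.Quotient.mk ((sq hq a a' hs).cast hx.symm hx'.symm)) =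
      Th hq w' x' h' := by
  subst hx hx'
  have hs2 : SegIn (VV n) w.1 w'.1 := by
    intro t ht
    rw [hw, hw', ← sg_comp]
    exact VV_comp (hs t ht) π
  refine Th_trans hq w w' (segP w w' (seg_mo w.2 w'.2 hs2)) _ _ h h' _ fun t => ?_
  refine (hq.eq_iff _ _).2 ⟨π, ?_⟩
  change sg w.1 w'.1 t = sg a.1 a'.1 t ∘ π
  rw [hw, hw', ← sg_comp]

/-- the loop comparing two orderings -/
def Lam (w w' : Mo n) (h : jj q w' = jj q w) : FundamentalGroup X (jj q (w0 n)) :=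
  (Th hq w' (jj q w) h).trans (Th hq w (jj q w) rfl).symm

theorem Lam_eq (w w' : Mo n) (x : X) (h : jj q w = x) (h' : jj q w' = x) :
    Lam hq w w' (h'.trans h.symm) = (Th hq w' x h').trans (Th hq w x h).symm := by
  subst h; rfl

theorem Lam_mul (w w' w'' : Mo n) (h : jj q w' = jj q w) (h' : jj q w'' = jj q w') :
    Lam hq w w' h * Lam hq w' w'' h' = Lam hq w w'' (h'.trans h) := by
  rw [FundamentalGroup.mul_def, Lam_eq hq w' w'' (jj q w) h (h'.trans h)]
  unfold Lam
  rw [hq_assoc, hq_symm_trans_assoc]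

theorem Lam_self (w : Mo n) : Lam hq w w rfl = 1 := hq_trans_symm _

theorem Lam_seg (w w1 w' w1' : Mo n) (π : Equiv.Perm (Fin n)) (hs : SegIn (VV n) w.1 w1.1)
    (hw : w'.1 = w.1 ∘ π) (hw1 : w1'.1 = w1.1 ∘ π) (h : jj q w' = jj q w)
    (h1 : jj q w1' = jj q w1) : Lam hq w w' h = Lam hq w1 w1' h1 := by
  have e1 := segS hq ⟨w.1, w.2.1⟩ ⟨w1.1, w1.2.1⟩ hs w w1 1 rfl rfl (jj q w) (jj q w1) rfl rfl rfl rfl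
  have e2 := segS hq ⟨w.1, w.2.1⟩ ⟨w1.1, w1.2.1⟩ hs w' w1' π hw hw1 (jj q w) (jj q w1) rfl rfl h h1
  unfold Lam
  rw [← e1, ← e2, hq_symm_of_trans, hq_assoc, hq_trans_symm_assoc]

end
end URProof

namespace URProof

def good (a b : PP) : Prop := sepc a b ∨ nst a b ∨ nst b a

/-- two circles at the same height, at positions `k`, `k+1` -/
def pc (n k : ℕ) (A B : ℂ × ℝ) : VS n :=
  cfg n (fun i => if i = k + 1 then k else i) (fun i => if i = k then A else if i = k + 1 then B else (0, 1))

theorem pc_mem (n k : ℕ) (A B : ℂ × ℝ) (hA : 0 < A.2) (hB : 0 < B.2)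
    (h : good (0, A) (0, B)) : pc n k A B ∈ Mo n := by
  refine cfg_mem n _ _ (fun i => ?_) (fun i j hij => ?_) fun i j hij hx => ?_
  · split_ifs <;> simp [hA, hB]
  · split_ifs <;> omega
  · have h1 : i = k := by split_ifs at hx <;> omega
    have h2 : j = k + 1 := by split_ifs at hx <;> omega
    subst h1 h2
    simpa [good] using h

theorem pc_tie (n k : ℕ) (A B : ℂ × ℝ) (i j : Fin n) (hij : i < j)
    (hx : (pc n k A B i).1 = (pc n k A B j).1) : (i : ℕ) = k ∧ (j : ℕ) = k + 1 := by
  have hij' : (i : ℕ) < j := hij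
  have hx := Nat.cast_injective (R := ℝ) hx
  dsimp only at hx
  constructor <;> split_ifs at hx <;> omega

theorem pc_k (n k : ℕ) (hk : k + 1 < n) (A B : ℂ × ℝ) : pc n k A B ⟨k, by omega⟩ = ((k : ℝ), A) := by
  simp [pc, cfg]
theorem pc_k1 (n k : ℕ) (hk : k + 1 < n) (A B : ℂ × ℝ) : pc n k A B ⟨k + 1, hk⟩ = ((k : ℝ), B) := by
  simp [pc, cfg]

theorem Mo_sw {n : ℕ} {w : VS n} (hw : w ∈ Mo n) (k : ℕ) (hk : k + 1 < n)
    (ht : (w ⟨k, by omega⟩).1 = (w ⟨k + 1, hk⟩).1) : w ∘ sw k hk ∈ Mo n := by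
  refine ⟨VV_comp hw.1 _, fun i j hij => ?_⟩
  rcases eq_or_lt_of_le hij with rfl | hij
  · exact le_rfl
  rcases sw_lt k hk i j hij with h | ⟨h1, h2⟩
  · exact hw.2 h.le
  · obtain rfl : i = ⟨k, Nat.lt_of_succ_lt hk⟩ := Fin.ext h1
    obtain rfl : j = ⟨k + 1, hk⟩ := Fin.ext h2
    simp only [Function.comp, sw_left, sw_right]
    exact ht.symm.le

theorem sw_sw {n : ℕ} (w : VS n) (k : ℕ) (hk : k + 1 < n) : (w ∘ sw k hk) ∘ sw k hk = w := by
  have : (w ∘ sw k hk) ∘ sw k hk = w ∘ (sw k hk * sw k hk : Equiv.Perm (Fin n)) := rfl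
  rw [this, sw_mul_self]; rfl

/-- a segment from a configuration with only one tie -/
theorem pc_seg {n k : ℕ} (hk : k + 1 < n) {A B : ℂ × ℝ} {w : VS n} (hA : pc n k A B ∈ Mo n)
    (hw : w ∈ Mo n) (h : ∀ t ∈ Set.Icc (0:ℝ) 1,
      good (sg (pc n k A B) w t ⟨k, by omega⟩) (sg (pc n k A B) w t ⟨k + 1, hk⟩)) :
    SegIn (VV n) (pc n k A B) w := by
  refine seg_ref hA hw fun i j hij hx t ht => ?_
  obtain ⟨h1, h2⟩ := pc_tie n k A B i j hij hx
  obtain rfl : i = ⟨k, Nat.lt_of_succ_lt hk⟩ := Fin.ext h1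
  obtain rfl : j = ⟨k + 1, hk⟩ := Fin.ext h2
  exact h t ht

theorem nst_sg {n : ℕ} {a b : VS n} {i j : Fin n} (ha : nst (a i) (a j)) (hb : nst (b i) (b j))
    {t : ℝ} (ht : t ∈ Set.Icc (0:ℝ) 1) : nst (sg a b t i) (sg a b t j) := by
  unfold nst at *
  simp only [sg_c, sg_r]
  have e : (1 - t) • (a i).2.1 + t • (b i).2.1 - ((1 - t) • (a j).2.1 + t • (b j).2.1) =
      (1 - t) • ((a i).2.1 - (a j).2.1) + t • ((b i).2.1 - (b j).2.1) := by
    simp only [smul_sub]; abel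
  rw [e]
  have h1 : 0 ≤ 1 - t := by linarith [ht.2]
  have h2 := ht.1
  have := norm_add_le ((1 - t) • ((a i).2.1 - (a j).2.1)) (t • ((b i).2.1 - (b j).2.1))
  rw [norm_smul, norm_smul, Real.norm_of_nonneg h1, Real.norm_of_nonneg h2] at this
  rcases eq_or_lt_of_le h2 with h3 | h3
  · subst h3; simp at this ⊢; linarith
  · have e1 := mul_le_mul_of_nonneg_left ha.le h1
    have e2 := mul_lt_mul_of_pos_left hb h3
    linarith

section
variable {n : ℕ} {X : Type} [TopologicalSpace X] {q : VV n → X} (hq : Quo q)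

include hq in
theorem jj_comp {w w' : VS n} (hw : w ∈ Mo n) (hw' : w' ∈ Mo n) (τ : Equiv.Perm (Fin n))
    (h : w' = w ∘ τ) : jj q ⟨w', hw'⟩ = jj q ⟨w, hw⟩ :=
  ((hq.eq_iff _ _).2 ⟨τ, h⟩).symm

open Classical in
/-- total version of `Lam` -/
def LT (w w' : VS n) : FundamentalGroup X (jj q (w0 n)) :=
  if h : ∃ (a : w ∈ Mo n) (b : w' ∈ Mo n), jj q ⟨w', b⟩ = jj q ⟨w, a⟩ then
    Lam hq ⟨w, h.choose⟩ ⟨w', h.choose_spec.choose⟩ h.choose_spec.choose_spec else 1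

theorem LT_eq (w w' : Mo n) (h : jj q w' = jj q w) : LT hq w.1 w'.1 = Lam hq w w' h := by
  unfold LT
  rw [dif_pos ⟨w.2, w'.2, h⟩]

theorem LT_mul {w : VS n} (hw : w ∈ Mo n) (τ τ' : Equiv.Perm (Fin n)) (h1 : w ∘ τ ∈ Mo n)
    (h2 : (w ∘ τ) ∘ τ' ∈ Mo n) :
    LT hq w (w ∘ τ) * LT hq (w ∘ τ) ((w ∘ τ) ∘ τ') = LT hq w ((w ∘ τ) ∘ τ') := by
  have e1 := LT_eq hq ⟨w, hw⟩ ⟨_, h1⟩ (jj_comp hq hw h1 τ rfl)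
  have e2 := LT_eq hq ⟨_, h1⟩ ⟨_, h2⟩ (jj_comp hq h1 h2 τ' rfl)
  have e3 := LT_eq hq ⟨w, hw⟩ ⟨_, h2⟩ (jj_comp hq hw h2 (τ * τ') rfl)
  simp only at e1 e2 e3
  rw [e1, e2, e3, Lam_mul]

theorem LT_self {w : VS n} (hw : w ∈ Mo n) : LT hq w w = 1 := by
  have e1 := LT_eq hq ⟨w, hw⟩ ⟨w, hw⟩ rfl
  simp only at e1
  rw [e1, Lam_self]

theorem LT_seg {w w1 : VS n} (hw : w ∈ Mo n) (hw1 : w1 ∈ Mo n) (τ : Equiv.Perm (Fin n))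
    (h : w ∘ τ ∈ Mo n) (h1 : w1 ∘ τ ∈ Mo n) (hs : SegIn (VV n) w w1) :
    LT hq w (w ∘ τ) = LT hq w1 (w1 ∘ τ) := by
  have e1 := LT_eq hq ⟨w, hw⟩ ⟨_, h⟩ (jj_comp hq hw h τ rfl)
  have e2 := LT_eq hq ⟨w1, hw1⟩ ⟨_, h1⟩ (jj_comp hq hw1 h1 τ rfl)
  simp only at e1 e2
  rw [e1, e2]
  exact Lam_seg hq _ _ _ _ τ hs rfl rfl _ _

/-- elementary loops -/
def LL (k : ℕ) (w : VS n) : FundamentalGroup X (jj q (w0 n)) :=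
  if hk : k + 1 < n then LT hq w (w ∘ sw k hk) else 1

theorem LL_def {k : ℕ} (hk : k + 1 < n) (w : VS n) : LL hq k w = LT hq w (w ∘ sw k hk) := by
  unfold LL; rw [dif_pos hk]

theorem LL_sw {k : ℕ} (hk : k + 1 < n) {w : VS n} (hw : w ∈ Mo n)
    (ht : (w ⟨k, by omega⟩).1 = (w ⟨k + 1, hk⟩).1) : LL hq k w * LL hq k (w ∘ sw k hk) = 1 := by
  rw [LL_def hq hk, LL_def hq hk, LT_mul hq hw _ _ (Mo_sw hw k hk ht), sw_sw, LT_self hq hw]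
  rwa [sw_sw]

theorem LL_seg {k : ℕ} (hk : k + 1 < n) {A B : ℂ × ℝ} {w : VS n} (hA : pc n k A B ∈ Mo n)
    (hw : w ∈ Mo n) (ht : (w ⟨k, by omega⟩).1 = (w ⟨k + 1, hk⟩).1)
    (h : ∀ t ∈ Set.Icc (0:ℝ) 1,
      good (sg (pc n k A B) w t ⟨k, by omega⟩) (sg (pc n k A B) w t ⟨k + 1, hk⟩)) :
    LL hq k (pc n k A B) = LL hq k w := by
  rw [LL_def hq hk, LL_def hq hk]
  refine LT_seg hq hA hw _ (Mo_sw hA k hk ?_) (Mo_sw hw k hk ht) (pc_seg hk hA hw h)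
  rw [pc_k n k hk, pc_k1 n k hk]

def lr (k : ℕ) : FundamentalGroup X (jj q (w0 n)) := LL hq k (pc n k (0, 1) (0, 2))
def ls (k : ℕ) : FundamentalGroup X (jj q (w0 n)) := LL hq k (pc n k (0, 1) (3, 1))

theorem claimN {k : ℕ} (hk : k + 1 < n) {w : VS n} (hw : w ∈ Mo n)
    (ht : (w ⟨k, by omega⟩).1 = (w ⟨k + 1, hk⟩).1) (h : nst (w ⟨k, by omega⟩) (w ⟨k + 1, hk⟩)) :
    LL hq k w = lr hq k := by
  symm
  refine LL_seg hq hk (pc_mem n k _ _ (by simp) (by simp) (Or.inr (Or.inl ?_))) hw ht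
    fun t ht => Or.inr (Or.inl (nst_sg ?_ h ht))
  · simp [nst]
  · rw [pc_k n k hk, pc_k1 n k hk]; simp [nst]

theorem sep_mem {k : ℕ} {D : ℂ} (hD : ‖D‖ = 3) : pc n k (0, 1) (D, 1) ∈ Mo n :=
  pc_mem n k _ _ (by simp) (by simp) (Or.inl (by simp [sepc, hD]; norm_num))

theorem claimS1 {k : ℕ} (hk : k + 1 < n) {w : VS n} (hw : w ∈ Mo n)
    (ht : (w ⟨k, by omega⟩).1 = (w ⟨k + 1, hk⟩).1) (h : sepc (w ⟨k, by omega⟩) (w ⟨k + 1, hk⟩)) :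
    ∃ D : ℂ, ‖D‖ = 3 ∧ LL hq k (pc n k (0, 1) (D, 1)) = LL hq k w := by
  set c := (w ⟨k, by omega⟩).2.1 with hc
  set c' := (w ⟨k + 1, hk⟩).2.1 with hc'
  have hp1 := hw.1.1 ⟨k, by omega⟩
  have hp2 := hw.1.1 ⟨k + 1, hk⟩
  have hd : 0 < ‖c' - c‖ := by
    rw [norm_sub_rev]; unfold sepc at h; rw [← hc, ← hc'] at h; linarith
  have hD : ‖(3 / ‖c' - c‖) • (c' - c)‖ = 3 := by
    rw [norm_smul, Real.norm_of_nonneg (by positivity)]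
    field_simp
  refine ⟨(3 / ‖c' - c‖) • (c' - c), hD, ?_⟩
  refine LL_seg hq hk (sep_mem hD) hw ht fun t ht => Or.inl ?_
  unfold sepc at *
  rw [← hc, ← hc', norm_sub_rev] at h
  simp only [sg_c, sg_r, pc_k n k hk, pc_k1 n k hk, ← hc, ← hc']
  have h1 : 0 ≤ 1 - t := by linarith [ht.2]
  have h2 := ht.1
  have e : (1 - t) • (0 : ℂ) + t • c - ((1 - t) • (3 / ‖c' - c‖) • (c' - c) + t • c') =
      -(((1 - t) * (3 / ‖c' - c‖) + t) • (c' - c)) := by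
    simp only [add_smul, mul_smul, smul_sub, smul_zero]; abel
  rw [e, norm_neg, norm_smul, Real.norm_of_nonneg (by positivity), add_mul]
  have e2 : (1 - t) * (3 / ‖c' - c‖) * ‖c' - c‖ = (1 - t) * 3 := by field_simp
  rw [e2]
  rcases eq_or_lt_of_le h2 with h3 | h3
  · subst h3; norm_num
  · have e2 := mul_lt_mul_of_pos_left h h3
    linarith

theorem claimS2 {k : ℕ} (hk : k + 1 < n) {D D' : ℂ} (hD : ‖D‖ = 3) (hD' : ‖D'‖ = 3)
    (h : 0 ≤ D.re * D'.re + D.im * D'.im) :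
    LL hq k (pc n k (0, 1) (D, 1)) = LL hq k (pc n k (0, 1) (D', 1)) := by
  refine LL_seg hq hk (sep_mem hD) (sep_mem hD') ?_ fun t ht => Or.inl ?_
  · rw [pc_k n k hk, pc_k1 n k hk]
  unfold sepc
  simp only [sg_c, sg_r, pc_k n k hk, pc_k1 n k hk]
  have e1 : D.re * D.re + D.im * D.im = 9 := by
    have := Complex.sq_norm D; rw [hD, Complex.normSq_apply] at this; linarith
  have e2 : D'.re * D'.re + D'.im * D'.im = 9 := by
    have := Complex.sq_norm D'; rw [hD', Complex.normSq_apply] at this; linarith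
  have h1 : 0 ≤ 1 - t := by linarith [ht.2]
  have h2 := ht.1
  have e3 : (1 - t) • (0:ℂ) + t • (0:ℂ) - ((1 - t) • D + t • D') = -((1 - t) • D + t • D') := by
    simp
  rw [e3, norm_neg, show (1 - t) * 1 + t * 1 + ((1 - t) * 1 + t * 1) = 2 by ring]
  refine lt_of_pow_lt_pow_left₀ 2 (norm_nonneg _) ?_
  rw [Complex.sq_norm, Complex.normSq_apply]
  simp only [Complex.add_re, Complex.smul_re, Complex.add_im, Complex.smul_im, smul_eq_mul]
  have e4 := mul_nonneg (mul_nonneg h2 h1) h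
  nlinarith [sq_nonneg (2 * t - 1)]

theorem claimS {k : ℕ} (hk : k + 1 < n) {w : VS n} (hw : w ∈ Mo n)
    (ht : (w ⟨k, by omega⟩).1 = (w ⟨k + 1, hk⟩).1) (h : sepc (w ⟨k, by omega⟩) (w ⟨k + 1, hk⟩)) :
    LL hq k w = ls hq k := by
  obtain ⟨D, hD, e⟩ := claimS1 hq hk hw ht h
  rw [← e]
  unfold ls
  have n3 : ‖(3 : ℂ)‖ = 3 := by simp
  have ni : ‖(3 * Complex.I : ℂ)‖ = 3 := by simp
  have ni' : ‖(-(3 * Complex.I) : ℂ)‖ = 3 := by simp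
  rcases le_or_gt 0 D.re with h1 | h1
  · exact claimS2 hq hk hD n3 (by simpa using h1)
  · rcases le_or_gt 0 D.im with h2 | h2
    · rw [claimS2 hq hk hD ni (by simpa using h2)]
      exact claimS2 hq hk ni n3 (by simp)
    · rw [claimS2 hq hk hD ni' (by simp; linarith)]
      exact claimS2 hq hk ni' n3 (by simp)

open Classical in
def yy {A : Type*} [Group A] (ρ σ : ℕ → A) (k : ℕ) (a b : PP) : A :=
  if nst a b then ρ k else if nst b a then (ρ k)⁻¹ else σ k

theorem LL_yy {k : ℕ} (hk : k + 1 < n) {w : VS n} (hw : w ∈ Mo n)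
    (ht : (w ⟨k, by omega⟩).1 = (w ⟨k + 1, hk⟩).1) :
    LL hq k w = yy (lr hq) (ls hq) k (w ⟨k, by omega⟩) (w ⟨k + 1, hk⟩) := by
  unfold yy
  split_ifs with h1 h2
  · exact claimN hq hk hw ht h1
  · have := LL_sw hq hk hw ht
    rw [claimN hq hk (w := w ∘ sw k hk) (Mo_sw hw k hk ht)] at this
    · exact eq_inv_of_mul_eq_one_left this
    · simp only [Function.comp, sw_left, sw_right]; exact ht.symm
    · simp only [Function.comp, sw_left, sw_right]; exact h2
  · refine claimS hq hk hw ht ?_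
    rcases hw.1.2 ⟨k, by omega⟩ ⟨k + 1, hk⟩ (by simp) ht with h | h | h
    · exact h
    · exact absurd h h1
    · exact absurd h h2

theorem ls_sq {k : ℕ} (hk : k + 1 < n) : ls hq k * ls hq k = 1 := by
  have hm : pc n k (0, 1) (3, 1) ∈ Mo n := sep_mem (by simp)
  have ht : (pc n k (0, 1) (3, 1) ⟨k, by omega⟩).1 = (pc n k (0, 1) (3, 1) ⟨k + 1, hk⟩).1 := by
    rw [pc_k n k hk, pc_k1 n k hk]
  have := LL_sw hq hk hm ht
  rwa [claimS hq hk (w := pc n k (0, 1) (3, 1) ∘ sw k hk) (Mo_sw hm k hk ht)] at this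
  · simp only [Function.comp, sw_left, sw_right]; exact ht.symm
  · simp only [Function.comp, sw_left, sw_right, pc_k n k hk, pc_k1 n k hk]
    simp [sepc]; norm_num

theorem ll_comm {k l : ℕ} (hkl : k + 2 ≤ l) (hl : l + 1 < n) {w : VS n} (hw : w ∈ Mo n)
    (ht : (w ⟨k, by omega⟩).1 = (w ⟨k + 1, by omega⟩).1)
    (ht' : (w ⟨l, by omega⟩).1 = (w ⟨l + 1, hl⟩).1) :
    Commute (yy (lr hq) (ls hq) k (w ⟨k, by omega⟩) (w ⟨k + 1, by omega⟩))
      (yy (lr hq) (ls hq) l (w ⟨l, by omega⟩) (w ⟨l + 1, hl⟩)) := by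
  have hk : k + 1 < n := by omega
  have a1 : (sw k hk) ⟨l, by omega⟩ = ⟨l, by omega⟩ := sw_ne _ _ _ (by simp; omega) (by simp; omega)
  have a2 : (sw k hk) ⟨l + 1, hl⟩ = ⟨l + 1, hl⟩ := sw_ne _ _ _ (by simp; omega) (by simp; omega)
  have b1 : (sw l hl) ⟨k, by omega⟩ = ⟨k, by omega⟩ := sw_ne _ _ _ (by simp; omega) (by simp; omega)
  have b2 : (sw l hl) ⟨k + 1, hk⟩ = ⟨k + 1, hk⟩ := sw_ne _ _ _ (by simp; omega) (by simp; omega)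
  have m1 := Mo_sw hw k hk ht
  have m2 := Mo_sw hw l hl ht'
  have t1 : ((w ∘ sw k hk) ⟨l, by omega⟩).1 = ((w ∘ sw k hk) ⟨l + 1, hl⟩).1 := by
    simp only [Function.comp, a1, a2]; exact ht'
  have t2 : ((w ∘ sw l hl) ⟨k, by omega⟩).1 = ((w ∘ sw l hl) ⟨k + 1, hk⟩).1 := by
    simp only [Function.comp, b1, b2]; exact ht
  have m1' := Mo_sw m1 l hl t1
  have m2' := Mo_sw m2 k hk t2
  have E1 := LL_yy hq hk hw ht
  have E2 := LL_yy hq hl m1 t1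
  have F1 := LL_yy hq hl hw ht'
  have F2 := LL_yy hq hk m2 t2
  rw [LL_def hq hk] at E1 F2
  rw [LL_def hq hl] at E2 F1
  simp only [Function.comp_apply, a1, a2] at E2
  simp only [Function.comp_apply, b1, b2] at F2
  have e : (w ∘ sw k hk) ∘ sw l hl = (w ∘ sw l hl) ∘ sw k hk := by
    have : sw k hk * sw l hl = sw l hl * sw k hk := by
      refine Equiv.Perm.Disjoint.commute ?_
      intro i
      by_cases h1 : (i : ℕ) = k ∨ (i : ℕ) = k + 1
      · right; exact sw_ne _ _ _ (by omega) (by omega)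
      · left; exact sw_ne _ _ _ (by omega) (by omega)
    change w ∘ (sw k hk * sw l hl : Equiv.Perm (Fin n)) = w ∘ (sw l hl * sw k hk : Equiv.Perm (Fin n))
    rw [this]
  unfold Commute SemiconjBy
  have g1 := LT_mul hq hw _ _ m1 m1'
  have g2 := LT_mul hq hw _ _ m2 m2'
  rw [E1, E2] at g1
  rw [F1, F2] at g2
  rw [g1, g2, e]

theorem ll_braid {k : ℕ} (hk : k + 2 < n) {w : VS n} (hw : w ∈ Mo n)
    (ht : (w ⟨k, by omega⟩).1 = (w ⟨k + 1, by omega⟩).1)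
    (ht' : (w ⟨k + 1, by omega⟩).1 = (w ⟨k + 2, hk⟩).1) :
    yy (lr hq) (ls hq) k (w ⟨k, by omega⟩) (w ⟨k + 1, by omega⟩) *
      yy (lr hq) (ls hq) (k + 1) (w ⟨k, by omega⟩) (w ⟨k + 2, hk⟩) *
      yy (lr hq) (ls hq) k (w ⟨k + 1, by omega⟩) (w ⟨k + 2, hk⟩) =
    yy (lr hq) (ls hq) (k + 1) (w ⟨k + 1, by omega⟩) (w ⟨k + 2, hk⟩) *
      yy (lr hq) (ls hq) k (w ⟨k, by omega⟩) (w ⟨k + 2, hk⟩) *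
      yy (lr hq) (ls hq) (k + 1) (w ⟨k, by omega⟩) (w ⟨k + 1, by omega⟩) := by
  have hk1 : k + 1 < n := by omega
  set s := sw k hk1 with hs
  set u := sw (k + 1) hk with hu
  have s0 : s ⟨k, by omega⟩ = ⟨k + 1, hk1⟩ := sw_left _ _
  have s1 : s ⟨k + 1, hk1⟩ = ⟨k, by omega⟩ := sw_right _ _
  have s2 : s ⟨k + 2, hk⟩ = ⟨k + 2, hk⟩ := sw_ne _ _ _ (by simp) (by simp)
  have u0 : u ⟨k, by omega⟩ = ⟨k, by omega⟩ := sw_ne _ _ _ (by simp) (by simp; omega)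
  have u1 : u ⟨k + 1, hk1⟩ = ⟨k + 2, hk⟩ := sw_left _ _
  have u2 : u ⟨k + 2, hk⟩ = ⟨k + 1, hk1⟩ := sw_right _ _
  have m1 := Mo_sw hw k hk1 ht
  rw [← hs] at m1
  have t1 : ((w ∘ s) ⟨k + 1, hk1⟩).1 = ((w ∘ s) ⟨k + 2, hk⟩).1 := by
    simp only [Function.comp, s1, s2, ht, ht']
  have m2 := Mo_sw m1 (k + 1) hk t1
  rw [← hu] at m2
  have t2 : (((w ∘ s) ∘ u) ⟨k, by omega⟩).1 = (((w ∘ s) ∘ u) ⟨k + 1, hk1⟩).1 := by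
    simp only [Function.comp, s0, s2, u0, u1, ht']
  have m3 := Mo_sw m2 k hk1 t2
  rw [← hs] at m3
  have n1 := Mo_sw hw (k + 1) hk ht'
  rw [← hu] at n1
  have v1 : ((w ∘ u) ⟨k, by omega⟩).1 = ((w ∘ u) ⟨k + 1, hk1⟩).1 := by
    simp only [Function.comp, u0, u1, ht, ht']
  have n2 := Mo_sw n1 k hk1 v1
  rw [← hs] at n2
  have v2 : (((w ∘ u) ∘ s) ⟨k + 1, hk1⟩).1 = (((w ∘ u) ∘ s) ⟨k + 2, hk⟩).1 := by
    simp only [Function.comp, s1, s2, u0, u2, ht]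
  have n3 := Mo_sw n2 (k + 1) hk v2
  rw [← hu] at n3
  have E1 := LL_yy hq hk1 hw ht
  have E2 := LL_yy hq hk m1 t1
  have E3 := LL_yy hq hk1 m2 t2
  have F1 := LL_yy hq hk hw ht'
  have F2 := LL_yy hq hk1 n1 v1
  have F3 := LL_yy hq hk n2 v2
  rw [LL_def hq hk1, ← hs] at E1 E3 F2
  rw [LL_def hq hk, ← hu] at E2 F1 F3
  simp only [Function.comp_apply, s0, s1, s2, u0, u1, u2] at E2 E3 F2 F3
  have e : ((w ∘ s) ∘ u) ∘ s = ((w ∘ u) ∘ s) ∘ u := by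
    have : s * u * s = u * s * u := by
      ext1 i
      by_cases h0 : (i : ℕ) = k
      · obtain rfl : i = ⟨k, Nat.lt_of_succ_lt hk1⟩ := Fin.ext h0
        simp only [Equiv.Perm.mul_apply, s0, s1, s2, u0, u1, u2]
      by_cases h1 : (i : ℕ) = k + 1
      · obtain rfl : i = ⟨k + 1, hk1⟩ := Fin.ext h1
        simp only [Equiv.Perm.mul_apply, s0, s1, s2, u0, u1, u2]
      by_cases h2 : (i : ℕ) = k + 2
      · obtain rfl : i = ⟨k + 2, hk⟩ := Fin.ext h2
        simp only [Equiv.Perm.mul_apply, s0, s1, s2, u0, u1, u2]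
      have a1 : s i = i := sw_ne _ _ _ h0 h1
      have a2 : u i = i := sw_ne _ _ _ h1 h2
      simp only [Equiv.Perm.mul_apply, a1, a2]
    change w ∘ (s * u * s : Equiv.Perm (Fin n)) = w ∘ (u * s * u : Equiv.Perm (Fin n))
    rw [this]
  rw [← E1, ← E2, ← E3, ← F1, ← F2, ← F3, LT_mul hq hw _ _ m1 m2, LT_mul hq hw _ _ n1 n2]
  have g1 := LT_mul hq hw (s * u) s m2 m3
  have g2 := LT_mul hq hw (u * s) u n2 n3
  exact g1.trans ((congrArg (LT hq w) e).trans g2.symm)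

end
end URProof

namespace URProof

/-- three circles at the same height -/
def tc (n k : ℕ) (A B C : ℂ × ℝ) : VS n :=
  cfg n (fun i => if i = k + 1 ∨ i = k + 2 then k else i)
    (fun i => if i = k then A else if i = k + 1 then B else if i = k + 2 then C else (0, 1))

theorem tc_mem (n k : ℕ) (A B C : ℂ × ℝ) (hA : 0 < A.2) (hB : 0 < B.2) (hC : 0 < C.2)
    (h1 : good (0, A) (0, B)) (h2 : good (0, A) (0, C)) (h3 : good (0, B) (0, C)) :
    tc n k A B C ∈ Mo n := by
  refine cfg_mem n _ _ (fun i => ?_) (fun i j hij => ?_) fun i j hij hx => ?_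
  · split_ifs <;> simp [hA, hB, hC]
  · split_ifs <;> omega
  · have : (i = k ∧ j = k + 1) ∨ (i = k ∧ j = k + 2) ∨ (i = k + 1 ∧ j = k + 2) := by
      split_ifs at hx <;> omega
    rcases this with ⟨h1, h2⟩ | ⟨h1, h2⟩ | ⟨h1, h2⟩ <;> subst h1 h2
    · simpa [good] using h1
    · simpa [good] using h2
    · simpa [good] using h3

/-- two pairs of circles -/
def dc (n k l : ℕ) (A B C D : ℂ × ℝ) : VS n :=
  cfg n (fun i => if i = k + 1 then k else if i = l + 1 then l else i)
    (fun i => if i = k then A else if i = k + 1 then B else if i = l then C else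
      if i = l + 1 then D else (0, 1))

theorem dc_mem (n k l : ℕ) (hkl : k + 2 ≤ l) (A B C D : ℂ × ℝ) (hA : 0 < A.2) (hB : 0 < B.2)
    (hC : 0 < C.2) (hD : 0 < D.2)
    (h1 : good (0, A) (0, B)) (h2 : good (0, C) (0, D)) : dc n k l A B C D ∈ Mo n := by
  refine cfg_mem n _ _ (fun i => ?_) (fun i j hij => ?_) fun i j hij hx => ?_
  · split_ifs <;> simp [hA, hB, hC, hD]
  · split_ifs <;> omega
  · have : (i = k ∧ j = k + 1) ∨ (i = l ∧ j = l + 1) := by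
      split_ifs at hx <;> omega
    have g1 : l ≠ k := by omega
    have g2 : l ≠ k + 1 := by omega
    have g3 : l + 1 ≠ k := by omega
    rcases this with ⟨h1, h2⟩ | ⟨h1, h2⟩ <;> subst h1 h2
    · simpa [good] using h1
    · simpa [good, g1, g2, g3] using h2

theorem yy_n {A : Type*} [Group A] (ρ σ : ℕ → A) (k : ℕ) {a b : PP} (h : nst a b) :
    yy ρ σ k a b = ρ k := if_pos h
theorem yy_s {A : Type*} [Group A] (ρ σ : ℕ → A) (k : ℕ) {a b : PP} (ha : 0 < a.2.2)
    (hb : 0 < b.2.2) (h : sepc a b) : yy ρ σ k a b = σ k := by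
  unfold yy
  rw [if_neg (not_nst_of_sepc ha h), if_neg (not_nst_of_sepc hb (sepc_symm h))]

section
variable {n : ℕ} {X : Type} [TopologicalSpace X] {q : VV n → X} (hq : Quo q)

theorem braid3 {k : ℕ} (hk : k + 2 < n) (A B C : ℂ × ℝ) (hA : 0 < A.2) (hB : 0 < B.2)
    (hC : 0 < C.2) (h1 : good (0, A) (0, B)) (h2 : good (0, A) (0, C))
    (h3 : good (0, B) (0, C)) :
    yy (lr hq) (ls hq) k (k, A) (k, B) * yy (lr hq) (ls hq) (k + 1) (k, A) (k, C) *
      yy (lr hq) (ls hq) k (k, B) (k, C) =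
    yy (lr hq) (ls hq) (k + 1) (k, B) (k, C) * yy (lr hq) (ls hq) k (k, A) (k, C) *
      yy (lr hq) (ls hq) (k + 1) (k, A) (k, B) := by
  have := ll_braid hq hk (tc_mem n k A B C hA hB hC h1 h2 h3) (by simp [tc, cfg]) (by simp [tc, cfg])
  simpa [tc, cfg] using this

theorem comm2 {k l : ℕ} (hkl : k + 2 ≤ l) (hl : l + 1 < n) (A B C D : ℂ × ℝ) (hA : 0 < A.2)
    (hB : 0 < B.2) (hC : 0 < C.2) (hD : 0 < D.2)
    (h1 : good (0, A) (0, B)) (h2 : good (0, C) (0, D)) :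
    Commute (yy (lr hq) (ls hq) k (k, A) (k, B)) (yy (lr hq) (ls hq) l (l, C) (l, D)) := by
  have g1 : l ≠ k := by omega
  have g2 : l ≠ k + 1 := by omega
  have g3 : l + 1 ≠ k := by omega
  have := ll_comm hq hkl hl (dc_mem n k l hkl A B C D hA hB hC hD h1 h2) (by simp [dc, cfg, g3.symm])
    (by simp [dc, cfg, g1, g2, g3, g3.symm])
  simpa [dc, cfg, g1, g2, g3, g3.symm] using this

theorem nn0 (x y : ℝ) (r s : ℝ) (h : r < s) : nst (x, (0, r)) (y, (0, s)) := by simpa [nst] using h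
theorem ss0 (x y : ℝ) (d r s : ℝ) (h : r + s < |d|) : sepc (x, (0, r)) (y, ((d : ℂ), s)) := by
  simpa [sepc] using h

theorem rels_loops : Rels n (lr hq) (ls hq) := by
  have N : ∀ x y : ℝ, nst (x, ((0 : ℂ), 1)) (y, ((0 : ℂ), 2)) := by intros; simp [nst]
  have S : ∀ x y : ℝ, sepc (x, ((0 : ℂ), 1)) (y, ((3 : ℂ), 1)) := by intros; simp [sepc]; norm_num
  have yn : ∀ (x y : ℝ) k, yy (lr hq) (ls hq) k (x, ((0 : ℂ), 1)) (y, ((0 : ℂ), 2)) = lr hq k :=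
    fun x y k => yy_n _ _ _ (N x y)
  have ys : ∀ (x y : ℝ) k, yy (lr hq) (ls hq) k (x, ((0 : ℂ), 1)) (y, ((3 : ℂ), 1)) = ls hq k :=
    fun x y k => yy_s _ _ _ (by simp) (by simp) (S x y)
  refine ⟨?_, ?_, ?_, ?_, ?_, ?_, ?_, ?_, ?_, fun k hk => ls_sq hq hk⟩
  · intro k l hkl hl
    simpa only [yn, ys] using comm2 hq hkl hl (0, 1) (0, 2) (0, 1) (0, 2) (by simp) (by simp)
      (by simp) (by simp) (Or.inr (Or.inl (N _ _))) (Or.inr (Or.inl (N _ _)))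
  · intro k l hkl hl
    simpa only [yn, ys] using comm2 hq hkl hl (0, 1) (3, 1) (0, 1) (3, 1) (by simp) (by simp)
      (by simp) (by simp) (Or.inl (S _ _)) (Or.inl (S _ _))
  · intro k l hkl hl
    simpa only [yn, ys] using comm2 hq hkl hl (0, 1) (0, 2) (0, 1) (3, 1) (by simp) (by simp)
      (by simp) (by simp) (Or.inr (Or.inl (N _ _))) (Or.inl (S _ _))
  · intro k l hkl hl
    simpa only [yn, ys] using comm2 hq hkl hl (0, 1) (3, 1) (0, 1) (0, 2) (by simp) (by simp)
      (by simp) (by simp) (Or.inl (S _ _)) (Or.inr (Or.inl (N _ _)))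
  · intro k hk
    have N2 : ∀ x y : ℝ, nst (x, ((0 : ℂ), 1)) (y, ((0 : ℂ), 3)) := by intros; simp [nst]
    have N3 : ∀ x y : ℝ, nst (x, ((0 : ℂ), 2)) (y, ((0 : ℂ), 3)) := by
      intros; simp [nst]; norm_num
    have := braid3 hq hk (0, 1) (0, 2) (0, 3) (by simp) (by simp) (by simp)
      (Or.inr (Or.inl (N _ _))) (Or.inr (Or.inl (N2 _ _))) (Or.inr (Or.inl (N3 _ _)))
    simpa only [yn, yy_n _ _ _ (N2 _ _), yy_n _ _ _ (N3 _ _)] using this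
  · intro k hk
    have S2 : ∀ x y : ℝ, sepc (x, ((0 : ℂ), 1)) (y, ((6 : ℂ), 1)) := by
      intros; simp [sepc]; norm_num
    have S3 : ∀ x y : ℝ, sepc (x, ((3 : ℂ), 1)) (y, ((6 : ℂ), 1)) := by
      intros; simp only [sepc]; rw [show (3 - 6 : ℂ) = -3 by norm_num]; simp; norm_num
    have := braid3 hq hk (0, 1) (3, 1) (6, 1) (by simp) (by simp) (by simp)
      (Or.inl (S _ _)) (Or.inl (S2 _ _)) (Or.inl (S3 _ _))
    rw [yy_s (a := (_, ((0 : ℂ), 1))) (b := (_, ((6 : ℂ), 1))) _ _ _ (by simp) (by simp) (S2 _ _),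
      yy_s (a := (_, ((0 : ℂ), 1))) (b := (_, ((6 : ℂ), 1))) _ _ _ (by simp) (by simp) (S2 _ _),
      yy_s (a := (_, ((3 : ℂ), 1))) (b := (_, ((6 : ℂ), 1))) _ _ _ (by simp) (by simp) (S3 _ _),
      yy_s (a := (_, ((3 : ℂ), 1))) (b := (_, ((6 : ℂ), 1))) _ _ _ (by simp) (by simp) (S3 _ _),
      ys, ys] at this
    exact this
  · intro k hk
    have S2 : ∀ x y : ℝ, sepc (x, ((0 : ℂ), 1)) (y, ((10 : ℂ), 1)) := by
      intros; simp [sepc]; norm_num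
    have S3 : ∀ x y : ℝ, sepc (x, ((0 : ℂ), 2)) (y, ((10 : ℂ), 1)) := by
      intros; simp [sepc]; norm_num
    have := braid3 hq hk (0, 1) (0, 2) (10, 1) (by simp) (by simp) (by simp)
      (Or.inr (Or.inl (N _ _))) (Or.inl (S2 _ _)) (Or.inl (S3 _ _))
    rw [yy_s (a := (_, ((0 : ℂ), 1))) (b := (_, ((10 : ℂ), 1))) _ _ _ (by simp) (by simp) (S2 _ _),
      yy_s (a := (_, ((0 : ℂ), 1))) (b := (_, ((10 : ℂ), 1))) _ _ _ (by simp) (by simp) (S2 _ _),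
      yy_s (a := (_, ((0 : ℂ), 2))) (b := (_, ((10 : ℂ), 1))) _ _ _ (by simp) (by simp) (S3 _ _),
      yy_s (a := (_, ((0 : ℂ), 2))) (b := (_, ((10 : ℂ), 1))) _ _ _ (by simp) (by simp) (S3 _ _),
      yn, yn] at this
    exact this
  · intro k hk
    have S2 : ∀ x y : ℝ, sepc (x, ((10 : ℂ), 1)) (y, ((0 : ℂ), 1)) := by
      intros; simp [sepc]; norm_num
    have S3 : ∀ x y : ℝ, sepc (x, ((10 : ℂ), 1)) (y, ((0 : ℂ), 2)) := by
      intros; simp [sepc]; norm_num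
    have := braid3 hq hk (10, 1) (0, 1) (0, 2) (by simp) (by simp) (by simp)
      (Or.inl (S2 _ _)) (Or.inl (S3 _ _)) (Or.inr (Or.inl (N _ _)))
    rw [yy_s (a := (_, ((10 : ℂ), 1))) (b := (_, ((0 : ℂ), 1))) _ _ _ (by simp) (by simp) (S2 _ _),
      yy_s (a := (_, ((10 : ℂ), 1))) (b := (_, ((0 : ℂ), 1))) _ _ _ (by simp) (by simp) (S2 _ _),
      yy_s (a := (_, ((10 : ℂ), 1))) (b := (_, ((0 : ℂ), 2))) _ _ _ (by simp) (by simp) (S3 _ _),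
      yy_s (a := (_, ((10 : ℂ), 1))) (b := (_, ((0 : ℂ), 2))) _ _ _ (by simp) (by simp) (S3 _ _),
      yn, yn] at this
    exact this
  · intro k hk
    have N2 : ∀ x y : ℝ, nst (x, ((0 : ℂ), 1)) (y, ((0 : ℂ), 10)) := by intros; simp [nst]
    have N3 : ∀ x y : ℝ, nst (x, ((3 : ℂ), 1)) (y, ((0 : ℂ), 10)) := by
      intros; simp [nst]; norm_num
    have := braid3 hq hk (0, 1) (3, 1) (0, 10) (by simp) (by simp) (by simp)
      (Or.inl (S _ _)) (Or.inr (Or.inl (N2 _ _))) (Or.inr (Or.inl (N3 _ _)))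
    rw [yy_n (a := (_, ((0 : ℂ), 1))) (b := (_, ((0 : ℂ), 10))) _ _ _ (N2 _ _),
      yy_n (a := (_, ((0 : ℂ), 1))) (b := (_, ((0 : ℂ), 10))) _ _ _ (N2 _ _),
      yy_n (a := (_, ((3 : ℂ), 1))) (b := (_, ((0 : ℂ), 10))) _ _ _ (N3 _ _),
      yy_n (a := (_, ((3 : ℂ), 1))) (b := (_, ((0 : ℂ), 10))) _ _ _ (N3 _ _),
      ys, ys] at this
    exact this

/-! ### Injectivity -/

theorem mono_Th {E : Type} [TopologicalSpace E] {p : E → X} (cov : IsCoveringMap p)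
    (f : Mo n → E) (hf : Continuous f) (hp : ∀ w, p (f w) = jj q w) (w : Mo n) (x : X)
    (h : jj q w = x) :
    cov.monodromy (Th hq w x h) ⟨f (w0 n), hp _⟩ = ⟨f w, (hp w).trans h⟩ := by
  subst h
  refine cov.monodromy_eq_of_map_eq
    (Path.Homotopic.Quotient.mk ((PathConnectedSpace.somePath (w0 n) w).map hf)) ?_
  unfold Th
  refine congrArg Path.Homotopic.Quotient.mk (Path.ext (funext fun t => ?_))
  exact hp _

theorem mono_LL {E : Type} [TopologicalSpace E] {p : E → X} (cov : IsCoveringMap p)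
    (e : Mo n → GG n → E) (he : ∀ g, Continuous fun w => e w g) (hp : ∀ w g, p (e w g) = jj q w)
    (hsw : ∀ (w w' : Mo n) k (hk : k + 1 < n) g, w'.1 = w.1 ∘ sw k hk → e w' g =
      e w (xx (pρ n) (pσ n) (fun i j => nst (w.1 i) (w.1 j)) k ⟨k, by omega⟩ ⟨k + 1, hk⟩ * g))
    {k : ℕ} (hk : k + 1 < n) {w : VS n} (hw : w ∈ Mo n)
    (ht : (w ⟨k, by omega⟩).1 = (w ⟨k + 1, hk⟩).1) (g : GG n) :
    cov.monodromy (LL hq k w) ⟨e (w0 n) g, hp _ _⟩ =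
      ⟨e (w0 n) (yy (pρ n) (pσ n) k (w ⟨k, by omega⟩) (w ⟨k + 1, hk⟩) * g), hp _ _⟩ := by
  have hw' := Mo_sw hw k hk ht
  rw [LL_def hq hk]
  have e1 := LT_eq hq ⟨w, hw⟩ ⟨_, hw'⟩ (jj_comp hq hw hw' _ rfl)
  simp only at e1
  rw [e1]
  unfold Lam
  rw [cov.monodromy_trans_apply, mono_Th hq cov (fun w => e w g) (he g) (fun w => hp w g)]
  have a1 := mono_Th hq cov
    (fun w' => e w' (yy (pρ n) (pσ n) k (w ⟨k, by omega⟩) (w ⟨k + 1, hk⟩) * g)) (he _)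
    (fun w => hp w _) ⟨w, hw⟩ _ rfl
  have a2 := hsw ⟨w, hw⟩ ⟨_, hw'⟩ k hk g rfl
  apply (cov.monodromy_bijective (Th hq ⟨w, hw⟩ _ rfl)).1
  rw [← cov.monodromy_trans_apply, hq_symm_trans, cov.monodromy_refl, a1]
  exact Subtype.ext a2

theorem inj_of_gens (F : GG n →* FundamentalGroup X (jj q (w0 n)))
    (h1 : ∀ k, k + 1 < n → F (pρ n k) = lr hq k) (h2 : ∀ k, k + 1 < n → F (pσ n k) = ls hq k) :
    Function.Injective F := by
  obtain ⟨E, _, p, cov, e, he, hp, hinj, hsw⟩ := exists_cover hq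
  let M := cov.monodromyPerm (jj q (w0 n))
  let H : Subgroup (GG n) := 
    { carrier := {h | ∀ g, M (F h) ⟨e (w0 n) g, hp _ _⟩ = ⟨e (w0 n) (h * g), hp _ _⟩}
      one_mem' := fun g => by rw [map_one, map_one, one_mul]; rfl
      mul_mem' := fun {a b} ha hb g => by
        rw [map_mul, map_mul, Equiv.Perm.mul_apply, hb g, ha, mul_assoc]
      inv_mem' := fun {a} ha g => by
        rw [map_inv, map_inv, Equiv.Perm.inv_eq_iff_eq, ha, mul_inv_cancel_left] }
  have hH : H = ⊤ := by
    refine GG_closure n H (fun k hk g => ?_) (fun k hk g => ?_)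
    · have hm := pc_mem n k (0, 1) (0, 2) (by simp) (by simp) (Or.inr (Or.inl (by simp [nst])))
      have := mono_LL hq cov e he hp hsw hk hm (by rw [pc_k n k hk, pc_k1 n k hk]) g
      rw [pc_k n k hk, pc_k1 n k hk, yy_n _ _ _ (by simp [nst])] at this
      rw [h1 k hk]
      exact this
    · have hm := pc_mem n k (0, 1) (3, 1) (by simp) (by simp) (Or.inl (by simp [sepc]; norm_num))
      have := mono_LL hq cov e he hp hsw hk hm (by rw [pc_k n k hk, pc_k1 n k hk]) g
      rw [pc_k n k hk, pc_k1 n k hk, yy_s _ _ _ (by simp) (by simp)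
        (by simp [sepc]; norm_num)] at this
      rw [h2 k hk]
      exact this
  refine (injective_iff_map_eq_one F).2 fun h hh => ?_
  have hm : h ∈ H := hH ▸ Subgroup.mem_top h
  have := hm 1
  rw [hh, map_one, Equiv.Perm.one_apply] at this
  have := hinj _ _ _ (congrArg Subtype.val this)
  simpa using this.symm

end
end URProof

namespace URProof

section
variable {n : ℕ} {X : Type} [TopologicalSpace X] {q : VV n → X} (hq : Quo q)

theorem yy_mem (H : Subgroup (FundamentalGroup X (jj q (w0 n)))) 
    (h1 : ∀ k, k + 1 < n → lr hq k ∈ H) (h2 : ∀ k, k + 1 < n → ls hq k ∈ H) (k : ℕ)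
    (hk : k + 1 < n) (a b : PP) : yy (lr hq) (ls hq) k a b ∈ H := by
  unfold yy
  split_ifs
  · exact h1 k hk
  · exact H.inv_mem (h1 k hk)
  · exact h2 k hk

theorem LT_mem (H : Subgroup (FundamentalGroup X (jj q (w0 n)))) 
    (h1 : ∀ k, k + 1 < n → lr hq k ∈ H) (h2 : ∀ k, k + 1 < n → ls hq k ∈ H) {w : VS n}
    (hw : w ∈ Mo n) (τ : Equiv.Perm (Fin n)) (hτ : w ∘ τ ∈ Mo n) : LT hq w (w ∘ τ) ∈ H := by
  have := gallery (fun i j => (w i).1 = (w j).1) τ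
    (fun π => w ∘ π ∈ Mo n ∧ LT hq w (w ∘ π) ∈ H) ?_ 1 ?_ ?_
  · exact this.2
  · rintro π k hk ⟨hm, hH⟩ ht
    have hm2 : (w ∘ π) ∘ sw k hk ∈ Mo n := Mo_sw hm k hk ht
    refine ⟨hm2, ?_⟩
    have e := LT_mul hq hw π (sw k hk) hm hm2
    have e2 : LT hq (w ∘ π) ((w ∘ π) ∘ sw k hk) ∈ H := by
      rw [← LL_def hq hk, LL_yy hq hk hm ht]
      exact yy_mem hq H h1 h2 k hk _ _
    have e3 : w ∘ (π * sw k hk : Equiv.Perm (Fin n)) = (w ∘ π) ∘ sw k hk := rfl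
    rw [e3, ← e]
    exact H.mul_mem hH e2
  · intro i j hij hlt
    simp only [Equiv.Perm.one_apply] at hlt ⊢
    refine le_antisymm (hw.2 hij.le) ?_
    have := hτ.2 hlt.le
    simpa using this
  · refine ⟨hw, ?_⟩
    have : LT hq w (w ∘ (1 : Equiv.Perm (Fin n))) = LT hq w w := rfl
    rw [this, LT_self hq hw]
    exact H.one_mem

theorem Lam_mem (H : Subgroup (FundamentalGroup X (jj q (w0 n)))) 
    (h1 : ∀ k, k + 1 < n → lr hq k ∈ H) (h2 : ∀ k, k + 1 < n → ls hq k ∈ H) (w w' : Mo n)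
    (h : jj q w' = jj q w) : Lam hq w w' h ∈ H := by
  obtain ⟨τ, hτ⟩ := (hq.eq_iff _ _).1 h.symm
  have hτ : w'.1 = w.1 ∘ τ := hτ
  have := LT_mem hq H h1 h2 w.2 τ (hτ ▸ w'.2)
  rwa [← hτ, LT_eq hq w w' h] at this

/-- closing up a path -/
def KK (w w' : Mo n) {x x' : X} (h : jj q w = x) (h' : jj q w' = x') (c : HQ x x') :
    FundamentalGroup X (jj q (w0 n)) :=
  (Th hq w x h).trans (c.trans (Th hq w' x' h').symm)

theorem KK_trans (w w' w'' : Mo n) {x x' x'' : X} (h : jj q w = x) (h' : jj q w' = x')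
    (h'' : jj q w'' = x'') (c : HQ x x') (c' : HQ x' x'') :
    KK hq w w'' h h'' (c.trans c') = KK hq w' w'' h' h'' c' * KK hq w w' h h' c := by
  rw [FundamentalGroup.mul_def]
  unfold KK
  rw [hq_assoc, hq_assoc, hq_assoc, hq_symm_trans_assoc]

theorem KK_cast (w w' : Mo n) {x x' z z' : X} (h : jj q w = x) (h' : jj q w' = x') (c : Path x x')
    (hx : z = x) (hx' : z' = x') :
    KK hq w w' (h.trans hx.symm) (h'.trans hx'.symm) (Path.Homotopic.Quotient.mk (c.cast hx hx')) =
      KK hq w w' h h' (Path.Homotopic.Quotient.mk c) := by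
  subst hx hx'; rfl

theorem Mo_center {y : VV n} {a : VS n} (ha : a ∈ CB y) (π : Equiv.Perm (Fin n))
    (h : a ∘ π ∈ Mo n) : y.1 ∘ π ∈ Mo n := by
  refine ⟨VV_comp y.2 π, fun i j hij => ?_⟩
  by_contra hlt
  exact absurd ((rad_spec y).lt a ha _ _ (not_le.1 hlt)) (h.2 hij).not_gt

theorem convex_seg {S : Set (VS n)} (hS : Convex ℝ S) {a b : VS n} (ha : a ∈ S) (hb : b ∈ S) :
    SegIn S a b := fun t ht => hS ha hb (by linarith [ht.2]) ht.1 (by ring)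

theorem KK_loc (H : Subgroup (FundamentalGroup X (jj q (w0 n)))) 
    (h1 : ∀ k, k + 1 < n → lr hq k ∈ H) (h2 : ∀ k, k + 1 < n → ls hq k ∈ H) (w w' : Mo n)
    {x x' : X} (h : jj q w = x) (h' : jj q w' = x') (y : VV n) (c : Path x x')
    (hc : ∀ t, c t ∈ bs hq y) : KK hq w w' h h' (Path.Homotopic.Quotient.mk c) ∈ H := by
  have hsub : ∀ p ∈ CB y, p ∈ VV n := fun p hp => (rad_spec y).sub hp
  let qB : CB y → X := fun p => q ⟨p.1, hsub _ p.2⟩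
  have qBc : Continuous qB := hq.cont.comp (by fun_prop)
  have qBinj : Function.Injective qB := by
    intro p p' hpp
    obtain ⟨τ, hτ⟩ := (hq.eq_iff _ _).1 hpp
    have hτ : p'.1 = p.1 ∘ τ := hτ
    have := (rad_spec y).uniq p.1 p.2 τ (hτ ▸ p'.2)
    subst this
    exact Subtype.ext hτ.symm
  have qBo : IsOpenMap qB := by
    refine hq.opn.comp ?_
    intro U hU
    obtain ⟨V, hV, rfl⟩ := isOpen_induced_iff.1 hU
    refine isOpen_induced_iff.2 ⟨V ∩ CB y, hV.inter (isOpen_CB y), ?_⟩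
    ext p
    constructor
    · rintro ⟨hp1, hp2⟩
      exact ⟨⟨p.1, hp2⟩, hp1, rfl⟩
    · rintro ⟨p', hp', rfl⟩
      exact ⟨hp', p'.2⟩
  have emb := Topology.IsOpenEmbedding.of_continuous_injective_isOpenMap qBc qBinj qBo
  have hl : ∀ t, ∃ p : CB y, qB p = c t := by
    intro t
    obtain ⟨p, hp, hpc⟩ := hc t
    exact ⟨⟨p.1, hp⟩, hpc⟩
  choose f hf using hl
  have fc : Continuous f := by
    rw [emb.isInducing.continuous_iff]
    have : qB ∘ f = c := funext hf
    rw [this]; exact c.continuous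
  let y' : CB y := ⟨y.1, self_mem_CB y⟩
  let F : Path (f 0) (f 1) := ⟨⟨f, fc⟩, rfl, rfl⟩
  have sa := convex_seg (convex_CB y) (f 0).2 y'.2
  have sb := convex_seg (convex_CB y) (f 1).2 y'.2
  let G : Path (f 0) (f 1) := (segP (f 0) y' sa).trans (segP (f 1) y' sb).symm
  have hFG : F.Homotopic G := by
    have _ : ContractibleSpace (CB y) := (convex_CB y).contractibleSpace ⟨_, self_mem_CB y⟩
    exact Path.Homotopic.Quotient.eq.1 (Subsingleton.elim _ _)
  have e0 : x = qB (f 0) := ((hf 0).trans c.source).symm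
  have e1 : x' = qB (f 1) := ((hf 1).trans c.target).symm
  subst e0 e1
  have hcF : c = F.map qBc := Path.ext (funext fun t => (hf t).symm)
  have hcG : Path.Homotopic.Quotient.mk c = Path.Homotopic.Quotient.mk (G.map qBc) := by
    rw [hcF]
    exact Path.Homotopic.Quotient.eq.2 (hFG.map ⟨qB, qBc⟩)
  have hcG2 : Path.Homotopic.Quotient.mk c =
      (Path.Homotopic.Quotient.mk ((segP (f 0) y' sa).map qBc)).trans
      (Path.Homotopic.Quotient.mk ((segP (f 1) y' sb).map qBc)).symm := by
    rw [hcG]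
    refine congrArg Path.Homotopic.Quotient.mk ?_
    exact (Path.map_trans _ _ _)
  obtain ⟨π, hπ⟩ := (hq.eq_iff ⟨(f 0).1, hsub _ (f 0).2⟩ _).1 h.symm
  obtain ⟨π', hπ'⟩ := (hq.eq_iff ⟨(f 1).1, hsub _ (f 1).2⟩ _).1 h'.symm
  have hπ : w.1 = (f 0).1 ∘ π := hπ
  have hπ' : w'.1 = (f 1).1 ∘ π' := hπ'
  have m := Mo_center (f 0).2 π (hπ ▸ w.2)
  have m' := Mo_center (f 1).2 π' (hπ' ▸ w'.2)
  have hv : jj q ⟨_, m⟩ = q y := ((hq.eq_iff _ _).2 ⟨π, rfl⟩).symm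
  have hv' : jj q ⟨_, m'⟩ = q y := ((hq.eq_iff _ _).2 ⟨π', rfl⟩).symm
  have E0 := segS hq ⟨(f 0).1, hsub _ (f 0).2⟩ y (fun t ht => hsub _ (sa t ht)) w ⟨_, m⟩ π hπ rfl
    (qB (f 0)) (qB y') rfl rfl h hv
  have E1 := segS hq ⟨(f 1).1, hsub _ (f 1).2⟩ y (fun t ht => hsub _ (sb t ht)) w' ⟨_, m'⟩ π' hπ' rfl
    (qB (f 1)) (qB y') rfl rfl h' hv'
  have key : KK hq w w' h h' (Path.Homotopic.Quotient.mk c) =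
      Lam hq ⟨_, m'⟩ ⟨_, m⟩ (hv.trans hv'.symm) := by
    rw [Lam_eq hq ⟨_, m'⟩ ⟨_, m⟩ (qB y') hv' hv, ← E0, ← E1, hq_symm_of_trans]
    unfold KK
    rw [hcG2, hq_assoc, hq_assoc]
    rfl
  rw [key]
  exact Lam_mem hq H h1 h2 _ _ _

theorem surj_aux (H : Subgroup (FundamentalGroup X (jj q (w0 n)))) 
    (h1 : ∀ k, k + 1 < n → lr hq k ∈ H) (h2 : ∀ k, k + 1 < n → ls hq k ∈ H) : H = ⊤ := by
  refine eq_top_iff.2 fun g _ => ?_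
  obtain ⟨γ, rfl⟩ : ∃ γ : Path (jj q (w0 n)) (jj q (w0 n)), Path.Homotopic.Quotient.mk γ = g :=
    Path.Homotopic.Quotient.mk_surjective g
  let P : unitInterval → Prop := fun t => ∀ w (h : jj q w = γ t),
    KK hq (w0 n) w γ.source.symm h (Path.Homotopic.Quotient.mk (γ.subpath 0 t)) ∈ H
  have loc : IsLocallyConstant P := by
    rw [IsLocallyConstant.iff_eventually_eq]
    intro t0
    obtain ⟨y, hy⟩ := hq.surj (γ t0)
    have hmem : γ t0 ∈ bs hq y := ⟨y, self_mem_CB y, hy⟩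
    have hop : IsOpen (γ ⁻¹' bs hq y) := (isOpen_bs hq y).preimage γ.continuous
    obtain ⟨ε, hε, hb⟩ := Metric.isOpen_iff.1 hop t0 hmem
    filter_upwards [Metric.ball_mem_nhds t0 hε] with t ht
    have hin : ∀ s ∈ Set.uIcc t0 t, γ s ∈ bs hq y := by
      intro s hs
      refine hb ?_
      rw [Metric.mem_ball] at ht ⊢
      refine lt_of_le_of_lt ?_ ht
      have hs' : (s : ℝ) ∈ Set.uIcc (t0 : ℝ) (t : ℝ) := by
        rw [Set.mem_uIcc] at hs ⊢
        exact_mod_cast hs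
      have := Set.abs_sub_left_of_mem_uIcc hs'
      rwa [Subtype.dist_eq, Subtype.dist_eq, Real.dist_eq, Real.dist_eq]
    have hsub : ∀ a b, (a = t0 ∧ b = t) ∨ (a = t ∧ b = t0) → ∀ s, γ.subpath a b s ∈ bs hq y := by
      intro a b hab s
      have : γ.subpath a b s ∈ Set.range (γ.subpath a b) := ⟨s, rfl⟩
      rw [Path.range_subpath] at this
      obtain ⟨u, hu, hus⟩ := this
      rw [← hus]
      rcases hab with ⟨rfl, rfl⟩ | ⟨rfl, rfl⟩
      · exact hin u hu
      · exact hin u (by rwa [Set.uIcc_comm] at hu)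
    have step : ∀ a b, (a = t0 ∧ b = t) ∨ (a = t ∧ b = t0) → P a → P b := by
      intro a b hab ha w h
      obtain ⟨v, hv⟩ := jj_surj hq (γ a)
      have e : Path.Homotopic.Quotient.mk (γ.subpath 0 b) =
          (Path.Homotopic.Quotient.mk (γ.subpath 0 a)).trans
          (Path.Homotopic.Quotient.mk (γ.subpath a b)) :=
        (Path.Homotopic.Quotient.eq.2 ⟨Path.Homotopy.subpathTransSubpath γ 0 a b⟩).symm
      rw [e, KK_trans hq (w0 n) v w _ hv]
      exact H.mul_mem (KK_loc hq H h1 h2 _ _ _ _ y _ (hsub a b hab)) (ha v hv)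
    exact propext ⟨step t t0 (Or.inr ⟨rfl, rfl⟩), step t0 t (Or.inl ⟨rfl, rfl⟩)⟩
  have P0 : P 0 := by
    intro w h
    rw [Path.subpath_self]
    obtain ⟨y, hy⟩ := hq.surj (γ 0)
    exact KK_loc hq H h1 h2 _ _ _ _ y _ fun t => ⟨y, self_mem_CB y, hy⟩
  have P1 : P 1 := by rwa [loc.apply_eq_of_preconnectedSpace 1 0]
  have := P1 (w0 n) γ.target.symm
  rw [Path.subpath_zero_one, KK_cast hq (w0 n) (w0 n) rfl rfl γ γ.source γ.target] at this
  have hT : Th hq (w0 n) _ rfl = Path.Homotopic.Quotient.refl _ :=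
    Th_eq hq (w0 n) _ rfl (Path.refl _)
  unfold KK at this
  rw [hT, hq_refl_trans] at this
  have hr : (Path.Homotopic.Quotient.refl (jj q (w0 n))).symm = Path.Homotopic.Quotient.refl _ := by
    rw [← hq_refl_trans (Path.Homotopic.Quotient.refl (jj q (w0 n))).symm, hq_trans_symm]
  rw [hr, hq_trans_refl] at this
  exact this

include hq in
theorem main_iso : Nonempty (FundamentalGroup X (jj q (w0 n)) ≃* PresentedGroup (urRels n)) := by
  obtain ⟨F, h1, h2⟩ := exists_hom (rels_loops hq)
  have hs : F.range = ⊤ := surj_aux hq _ (fun k hk => ⟨_, h1 k hk⟩) (fun k hk => ⟨_, h2 k hk⟩)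
  exact ⟨(MulEquiv.ofBijective F ⟨inj_of_gens hq F h1 h2, MonoidHom.range_eq_top.1 hs⟩).symm⟩

include hq in
theorem main_iso' (x : X) : Nonempty (FundamentalGroup X x ≃* PresentedGroup (urRels n)) := by
  have : PathConnectedSpace X := (jj_surj hq).pathConnectedSpace (jj_cont hq)
  obtain ⟨f⟩ := main_iso hq
  exact ⟨(FundamentalGroup.fundamentalGroupMulEquivOfPathConnected x _).trans f⟩

end
end URProof

namespace URProof

theorem exists_perp (w : E3) (hw : w ≠ 0) : ∃ u : E3, ‖u‖ = ‖w‖ ∧ inner ℝ u w = (0 : ℝ) := by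
  have key : ∃ v : E3, v ≠ 0 ∧ inner ℝ v w = (0 : ℝ) := by
    by_cases h : w 1 = 0 ∧ w 2 = 0
    · refine ⟨!₂[0, 1, 0], ?_, ?_⟩
      · intro h0
        have := congrArg (fun z : E3 => z 1) h0
        simp at this
      · simp [PiLp.inner_apply, Fin.sum_univ_three, h.1]
    · refine ⟨!₂[0, w 2, - w 1], ?_, ?_⟩
      · intro h0
        have h1 := congrArg (fun z : E3 => z 1) h0
        have h2 := congrArg (fun z : E3 => z 2) h0
        simp at h1 h2
        exact h ⟨h2, h1⟩
      · simp [PiLp.inner_apply, Fin.sum_univ_three]; ring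
  obtain ⟨v, hv, hvw⟩ := key
  have hv' : ‖v‖ ≠ 0 := norm_ne_zero_iff.2 hv
  refine ⟨(‖w‖ / ‖v‖) • v, ?_, ?_⟩
  · rw [norm_smul, Real.norm_eq_abs, abs_of_nonneg (by positivity)]
    field_simp
  · rw [real_inner_smul_left, hvw, mul_zero]

theorem circle_aux (a b : E3 × E3) (ha : a.2 ≠ 0) (h : pCircle a ⊆ pCircle b) :
    ‖a.2‖ ^ 2 + ‖b.1 - a.1‖ ^ 2 = ‖b.2‖ ^ 2 := by
  obtain ⟨u, hu, huw⟩ := exists_perp a.2 ha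
  have h1 : a.1 + u ∈ pCircle b := h ⟨by simpa using hu, by simpa using huw⟩
  have h2 : a.1 - u ∈ pCircle b := h ⟨by simpa using hu, by
    rw [show a.1 - u - a.1 = -u by abel, inner_neg_left, huw, neg_zero]⟩
  have e1 := h1.1
  have e2 := h2.1
  rw [show a.1 + u - b.1 = u - (b.1 - a.1) by abel] at e1
  rw [show a.1 - u - b.1 = -(u + (b.1 - a.1)) by abel, norm_neg] at e2
  have f1 := norm_sub_sq_real u (b.1 - a.1)
  have f2 := norm_add_sq_real u (b.1 - a.1)
  rw [e1] at f1
  rw [e2] at f2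
  rw [← hu]; linarith

theorem circle_det {a b : E3 × E3} (ha : a.2 ≠ 0) (hb : b.2 ≠ 0) (h : pCircle a = pCircle b) :
    a.1 = b.1 ∧ ‖a.2‖ = ‖b.2‖ := by
  have h1 := circle_aux a b ha h.subset
  have h2 := circle_aux b a hb h.superset
  rw [norm_sub_rev a.1 b.1] at h2
  have h3 : ‖b.1 - a.1‖ ^ 2 = 0 := by linarith
  have h4 : b.1 - a.1 = 0 := norm_eq_zero.1 (pow_eq_zero_iff (two_ne_zero) |>.1 h3)
  refine ⟨(sub_eq_zero.1 h4).symm, ?_⟩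
  have h5 : ‖a.2‖ ^ 2 = ‖b.2‖ ^ 2 := by linarith
  exact (pow_left_inj₀ (norm_nonneg _) (norm_nonneg _) two_ne_zero).1 h5

/-- plane coordinate -/
def zc (z : E3) : ℂ := ⟨z 1, z 2⟩
def mk3 (x : ℝ) (c : ℂ) : E3 := !₂[x, c.re, c.im]
@[simp] theorem mk3_zero (x : ℝ) (c : ℂ) : mk3 x c 0 = x := by simp [mk3]
@[simp] theorem zc_mk3 (x : ℝ) (c : ℂ) : zc (mk3 x c) = c := by
  apply Complex.ext <;> simp [mk3, zc]
theorem mk3_zc (z : E3) : mk3 (z 0) (zc z) = z := by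
  ext i; fin_cases i <;> simp [mk3, zc]

/-- parameters -/
def par (a : E3 × E3) : PP := (a.1 0, zc a.1, ‖a.2‖)

def Untw (a : E3 × E3) : Prop := a.2 ≠ 0 ∧ a.2 1 = 0 ∧ a.2 2 = 0

theorem norm_zc (z : E3) (h : z 0 = 0) : ‖zc z‖ = ‖z‖ := by
  rw [EuclideanSpace.norm_eq, Complex.norm_def, Complex.normSq_apply, Fin.sum_univ_three, h]
  simp [zc, ← pow_two]

theorem zc_sub (z w : E3) : zc (z - w) = zc z - zc w := by
  apply Complex.ext <;> simp [zc]

theorem inner_untw {a : E3 × E3} (ha : Untw a) (z : E3) :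
    inner ℝ (z - a.1) a.2 = (0 : ℝ) ↔ z 0 = a.1 0 := by
  obtain ⟨h0, h1, h2⟩ := ha
  have h : a.2 0 ≠ 0 := by
    intro h; apply h0; ext i; fin_cases i <;> simp [h, h1, h2]
  simp [PiLp.inner_apply, Fin.sum_univ_three, h1, h2, h, sub_eq_zero]

theorem mem_circle {a : E3 × E3} (ha : Untw a) (z : E3) :
    z ∈ pCircle a ↔ z 0 = (par a).1 ∧ ‖zc z - (par a).2.1‖ = (par a).2.2 := by
  simp only [pCircle, circleSet, Set.mem_ofPred_eq, inner_untw ha, par]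
  rw [and_comm]
  refine and_congr_right fun h => ?_
  rw [← zc_sub, norm_zc _ (by simp [h])]

theorem mem_disk {a : E3 × E3} (ha : Untw a) (z : E3) :
    z ∈ pDisk a ↔ z 0 = (par a).1 ∧ ‖zc z - (par a).2.1‖ ≤ (par a).2.2 := by
  simp only [pDisk, diskSet, Set.mem_ofPred_eq, inner_untw ha, par]
  rw [and_comm]
  refine and_congr_right fun h => ?_
  rw [← zc_sub, norm_zc _ (by simp [h])]

theorem par_pos {a : E3 × E3} (ha : Untw a) : 0 < (par a).2.2 := norm_pos_iff.2 ha.1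

theorem circle_eq_of_par {a b : E3 × E3} (ha : Untw a) (hb : Untw b) (h : par a = par b) :
    pCircle a = pCircle b := by
  ext z; rw [mem_circle ha, mem_circle hb, h]

def Good (a b : PP) : Prop := a.1 = b.1 → sepc a b ∨ nst a b ∨ nst b a

theorem Good.symm {a b : PP} (h : Good a b) : Good b a := by
  intro e
  rcases h e.symm with h | h | h
  · left; unfold sepc at *; rw [norm_sub_rev, add_comm]; exact h
  · exact Or.inr (Or.inr h)
  · exact Or.inr (Or.inl h)

theorem good_disjoint {a b : E3 × E3} (ha : Untw a) (hb : Untw b) (h : Good (par a) (par b)) :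
    Disjoint (pCircle a) (pCircle b) := by
  rw [Set.disjoint_left]
  intro z hza hzb
  rw [mem_circle ha] at hza
  rw [mem_circle hb] at hzb
  have t1 := norm_sub_le_norm_sub_add_norm_sub (par a).2.1 (zc z) (par b).2.1
  have t2 := norm_sub_le_norm_sub_add_norm_sub (zc z) (par a).2.1 (par b).2.1
  have t3 := norm_sub_le_norm_sub_add_norm_sub (zc z) (par b).2.1 (par a).2.1
  rw [norm_sub_rev (par a).2.1 (zc z)] at t1
  rw [norm_sub_rev (par b).2.1 (par a).2.1] at t3
  rcases h (hza.1.symm.trans hzb.1) with h | h | h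
  · unfold sepc at h; linarith [hza.2, hzb.2]
  · unfold nst at h; linarith [hza.2, hzb.2]
  · unfold nst at h; rw [norm_sub_rev (par b).2.1 (par a).2.1] at h; linarith [hza.2, hzb.2]

theorem good_not_links {a b : E3 × E3} (ha : Untw a) (hb : Untw b) (h : Good (par a) (par b)) :
    ¬ LinksOnce a b := by
  rintro ⟨z, ⟨hza, hzb⟩, huniq⟩
  have hza' := hza
  rw [mem_circle ha] at hza
  rw [mem_disk hb] at hzb
  have t1 := norm_sub_le_norm_sub_add_norm_sub (par a).2.1 (zc z) (par b).2.1
  have t2 := norm_sub_le_norm_sub_add_norm_sub (zc z) (par b).2.1 (par a).2.1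
  rw [norm_sub_rev (par a).2.1 (zc z)] at t1
  rcases h (hza.1.symm.trans hzb.1) with h | h | h
  · unfold sepc at h; linarith [hza.2, hzb.2]
  · -- the antipode also lies in the disk
    set c := (par a).2.1 with hc
    have hw : mk3 (z 0) (2 * c - zc z) ∈ pCircle a ∩ pDisk b := by
      have e : 2 * c - zc z - c = -(zc z - c) := by ring
      have e1 : ‖2 * c - zc z - c‖ = (par a).2.2 := by rw [e, norm_neg]; exact hza.2
      refine ⟨(mem_circle ha _).2 ⟨by simpa using hza.1, by simpa using e1⟩,
        (mem_disk hb _).2 ⟨by simpa using hzb.1, ?_⟩⟩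
      rw [zc_mk3]
      have t3 := norm_sub_le_norm_sub_add_norm_sub (2 * c - zc z) c (par b).2.1
      unfold nst at h
      linarith
    have h3 := congrArg zc (huniq _ hw)
    rw [zc_mk3] at h3
    have h4 : zc z - c = 0 := by
      have : (2 : ℂ) * (zc z - c) = 0 := by linear_combination -h3
      simpa using this
    have := hza.2
    rw [h4, norm_zero] at this
    exact (par_pos ha).ne this
  · unfold nst at h; linarith [hza.2, hzb.2]

theorem exists_inter (c c' : ℂ) (r r' : ℝ) (hr : 0 < r) (hr' : 0 < r')
    (h1 : ‖c - c'‖ ≤ r + r') (h2 : r' ≤ ‖c - c'‖ + r) (h3 : r ≤ ‖c - c'‖ + r') :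
    ∃ z : ℂ, ‖z - c‖ = r ∧ ‖z - c'‖ = r' := by
  rcases eq_or_ne c c' with rfl | hne
  · have : r = r' := by simp at h2 h3; linarith
    subst this
    refine ⟨c + r, ?_, ?_⟩ <;> simp [abs_of_pos hr]
  · set d := ‖c - c'‖ with hd
    have hd0 : 0 < d := norm_pos_iff.2 (sub_ne_zero.2 hne)
    set s := (d ^ 2 + r ^ 2 - r' ^ 2) / (2 * d) with hs
    have hsd : 2 * d * s = d ^ 2 + r ^ 2 - r' ^ 2 := by rw [hs]; field_simp
    have hs1 : s ≤ r := by
      rw [hs, div_le_iff₀ (by positivity)]; nlinarith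
    have hs2 : -r ≤ s := by
      rw [hs, le_div_iff₀ (by positivity)]; nlinarith
    have hq : 0 ≤ r ^ 2 - s ^ 2 := by nlinarith
    set k := Real.sqrt (r ^ 2 - s ^ 2) with hk
    have hk2 : k ^ 2 = r ^ 2 - s ^ 2 := Real.sq_sqrt hq
    have hdc : (d : ℂ) ≠ 0 := by exact_mod_cast hd0.ne'
    have he : ‖(c' - c) / (d : ℂ)‖ = 1 := by
      rw [norm_div, norm_sub_rev, ← hd, Complex.norm_real, Real.norm_eq_abs, abs_of_pos hd0,
        div_self hd0.ne']
    have nrm : ∀ x R : ℝ, 0 < R → x ^ 2 + k ^ 2 = R ^ 2 → ‖(⟨x, k⟩ : ℂ)‖ = R := by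
      intro x R hR h
      rw [Complex.norm_def, Complex.normSq_apply]
      rw [show x * x + k * k = R ^ 2 by linarith, Real.sqrt_sq hR.le]
    refine ⟨c + (c' - c) / d * ⟨s, k⟩, ?_, ?_⟩
    · rw [add_sub_cancel_left, norm_mul, he, one_mul]
      exact nrm _ _ hr (by linarith)
    · have : c + (c' - c) / d * ⟨s, k⟩ - c' = (c' - c) / d * ⟨s - d, k⟩ := by
        have e : (⟨s - d, k⟩ : ℂ) = ⟨s, k⟩ - (d : ℂ) := by apply Complex.ext <;> simp
        rw [e, mul_sub, div_mul_cancel₀ _ hdc]; ring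
      rw [this, norm_mul, he, one_mul]
      exact nrm _ _ hr' (by nlinarith)

theorem good_of_disjoint {a b : E3 × E3} (ha : Untw a) (hb : Untw b)
    (h : Disjoint (pCircle a) (pCircle b)) : Good (par a) (par b) := by
  intro e
  by_contra hcon
  push Not at hcon
  obtain ⟨g1, g2, g3⟩ := hcon
  unfold sepc at g1
  unfold nst at g2 g3
  rw [norm_sub_rev (par b).2.1] at g3
  push Not at g1 g2 g3
  obtain ⟨z, hz1, hz2⟩ := exists_inter (par a).2.1 (par b).2.1 (par a).2.2 (par b).2.2
    (par_pos ha) (par_pos hb) g1 g2 g3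
  have m1 : mk3 (par a).1 z ∈ pCircle a := by
    rw [mem_circle ha]; exact ⟨by simp, by simpa using hz1⟩
  have m2 : mk3 (par a).1 z ∈ pCircle b := by
    rw [mem_circle hb]; exact ⟨by simpa using e, by simpa using hz2⟩
  exact Set.disjoint_left.1 h m1 m2

/-- standard lift -/
def plift (a : PP) : E3 × E3 := (mk3 a.1 a.2.1, mk3 a.2.2 0)

theorem plift_untw {a : PP} (h : 0 < a.2.2) : Untw (plift a) := by
  refine ⟨?_, ?_, ?_⟩
  · intro h0
    have := congrArg (fun z : E3 => z 0) h0
    simp [plift] at this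
    exact h.ne' this
  · simp [plift, mk3]
  · simp [plift, mk3]

theorem par_plift {a : PP} (h : 0 < a.2.2) : par (plift a) = a := by
  have : ‖mk3 a.2.2 0‖ = a.2.2 := by
    rw [EuclideanSpace.norm_eq, Fin.sum_univ_three]
    simp [mk3, Real.sqrt_sq h.le]
  simp [par, plift, this]

theorem cont_mk3 : Continuous fun p : ℝ × ℂ => mk3 p.1 p.2 := by
  refine (PiLp.continuous_toLp 2 _).comp ?_
  refine continuous_pi fun i => ?_
  fin_cases i
  · exact continuous_fst
  · exact Complex.continuous_re.comp continuous_snd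
  · exact Complex.continuous_im.comp continuous_snd

theorem cont_plift : Continuous plift := by
  refine Continuous.prodMk ?_ ?_
  · exact cont_mk3.comp (continuous_fst.prodMk (continuous_fst.comp continuous_snd))
  · exact cont_mk3.comp ((continuous_snd.comp continuous_snd).prodMk continuous_const)

theorem cont_zc : Continuous zc := by
  have : zc = fun z : E3 => ((z 1 : ℝ) : ℂ) + ((z 2 : ℝ) : ℂ) * Complex.I := by
    funext z; apply Complex.ext <;> simp [zc]
  rw [this]; fun_prop

theorem cont_par : Continuous par := by
  refine Continuous.prodMk (by fun_prop) (Continuous.prodMk ?_ (by fun_prop))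
  exact cont_zc.comp continuous_fst

theorem plift_ring {n : ℕ} {p : VS n} (hp : p ∈ VV n) : IsRingTuple fun i => plift (p i) := by
  have hu : ∀ i, Untw (plift (p i)) := fun i => plift_untw (hp.1 i)
  have hg : ∀ i j, i ≠ j → Good (par (plift (p i))) (par (plift (p j))) := by
    intro i j hij
    rw [par_plift (hp.1 i), par_plift (hp.1 j)]
    exact hp.2 i j hij
  exact ⟨fun i => (hu i).1, fun i j hij => good_disjoint (hu i) (hu j) (hg i j hij),
    fun i j hij => ⟨good_not_links (hu i) (hu j) (hg i j hij),
      good_not_links (hu j) (hu i) (hg i j hij).symm⟩⟩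

def pliftT {n : ℕ} (p : VV n) : RingTuple n := ⟨fun i => plift (p.1 i), plift_ring p.2⟩

theorem pliftT_untw {n : ℕ} (p : VV n) : IsUntwistedTuple (pliftT p) :=
  fun i => (plift_untw (p.2.1 i)).2

def qq (n : ℕ) (p : VV n) : ↥(URConf n) :=
  ⟨Quotient.mk (ringSetoid n) (pliftT p), pliftT p, rfl, pliftT_untw p⟩

theorem par_comp_of_range {n : ℕ} {f g : RingTuple n}
    (h : (Set.range fun i => pCircle (f.1 i)) = Set.range fun i => pCircle (g.1 i)) :
    ∃ τ : Equiv.Perm (Fin n), ∀ i, par (g.1 i) = par (f.1 (τ i)) := by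
  have hinj : ∀ g : RingTuple n, Function.Injective fun i => pCircle (g.1 i) := by
    intro g i j hij
    by_contra hne
    have hd := g.2.2.1 i j hne
    simp only at hij
    rw [hij, disjoint_self] at hd
    obtain ⟨u, hu, huw⟩ := exists_perp _ (g.2.1 j)
    have : (g.1 j).1 + u ∈ pCircle (g.1 j) := ⟨by simpa using hu, by simpa using huw⟩
    rw [hd] at this
    exact this
  have hex : ∀ i, ∃ j, pCircle (f.1 j) = pCircle (g.1 i) := by
    intro i
    have : pCircle (g.1 i) ∈ Set.range fun i => pCircle (f.1 i) := by rw [h]; exact ⟨i, rfl⟩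
    exact this
  choose t ht using hex
  have tinj : Function.Injective t := by
    intro i j hij
    apply hinj g
    simp only
    rw [← ht i, ← ht j, hij]
  refine ⟨Equiv.ofBijective t (Finite.injective_iff_bijective.1 tinj), fun i => ?_⟩
  obtain ⟨e1, e2⟩ := circle_det (f.2.1 _) (g.2.1 _) (ht i)
  simp only [Equiv.ofBijective_apply, par, e1, e2]

theorem par_mem {n : ℕ} {f : RingTuple n} (hf : IsUntwistedTuple f) :
    (fun i => par (f.1 i)) ∈ VV n := by
  have hu : ∀ i, Untw (f.1 i) := fun i => ⟨f.2.1 i, hf i⟩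
  exact ⟨fun i => par_pos (hu i), fun i j hij => good_of_disjoint (hu i) (hu j) (f.2.2.1 i j hij)⟩

theorem mk_plift {n : ℕ} {f : RingTuple n} (hf : IsUntwistedTuple f) :
    Quotient.mk (ringSetoid n) (pliftT ⟨_, par_mem hf⟩) = Quotient.mk (ringSetoid n) f := by
  apply Quotient.sound
  change Set.range _ = Set.range _
  congr 1
  funext i
  have hu : Untw (f.1 i) := ⟨f.2.1 i, hf i⟩
  exact circle_eq_of_par (plift_untw (par_pos hu)) hu (par_plift (par_pos hu))

theorem quo_q (n : ℕ) : Quo (qq n) where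
  cont := by
    refine Continuous.subtype_mk ?_ _
    refine continuous_quotient_mk'.comp ?_
    refine Continuous.subtype_mk ?_ _
    exact continuous_pi fun i => cont_plift.comp ((continuous_apply i).comp continuous_subtype_val)
  surj := by
    rintro ⟨_, f, rfl, hf⟩
    exact ⟨⟨_, par_mem hf⟩, Subtype.ext (mk_plift hf)⟩
  eq_iff := by
    intro p p'
    constructor
    · intro h
      have h1 : Quotient.mk (ringSetoid n) (pliftT p) = Quotient.mk (ringSetoid n) (pliftT p') :=
        congrArg Subtype.val h
      obtain ⟨τ, hτ⟩ := par_comp_of_range (Quotient.exact h1)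
      refine ⟨τ, funext fun i => ?_⟩
      have := hτ i
      simp only [pliftT] at this
      rwa [par_plift (p'.2.1 _), par_plift (p.2.1 _)] at this
    · rintro ⟨τ, hτ⟩
      apply Subtype.ext
      apply Quotient.sound
      change Set.range _ = Set.range _
      have : (fun i => pCircle ((pliftT p').1 i)) = (fun i => pCircle ((pliftT p).1 i)) ∘ τ := by
        funext i
        simp [pliftT, hτ]
      rw [this, τ.surjective.range_comp]
  opn := by
    intro O hO
    obtain ⟨O', hO', rfl⟩ := isOpen_induced_iff.1 hO
    set S : Set (RingTuple n) := {f | ∃ τ : Equiv.Perm (Fin n),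
      (fun i => par (f.1 (τ i))) ∈ O' ∩ VV n} with hS
    have hSo : IsOpen S := by
      have : S = ⋃ τ : Equiv.Perm (Fin n),
          (fun f : RingTuple n => fun i => par (f.1 (τ i))) ⁻¹' (O' ∩ VV n) := by
        ext f; simp [hS]
      rw [this]
      refine isOpen_iUnion fun τ => (hO'.inter (isOpen_VV n)).preimage ?_
      exact continuous_pi fun i => cont_par.comp
        ((continuous_apply (τ i)).comp continuous_subtype_val)
    have hsat : ∀ f g : RingTuple n,
        Quotient.mk (ringSetoid n) f = Quotient.mk (ringSetoid n) g → f ∈ S → g ∈ S := by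
      rintro f g h ⟨τ, hτ⟩
      obtain ⟨κ, hκ⟩ := par_comp_of_range (Quotient.exact h)
      refine ⟨τ.trans κ.symm, ?_⟩
      convert hτ using 2 with i
      rw [hκ]; simp
    have hQ : IsOpen ((Quotient.mk (ringSetoid n)) '' S) := by
      apply isOpen_coinduced.2
      convert hSo using 1
      ext f
      constructor
      · rintro ⟨g, hg, hgf⟩
        exact hsat g f hgf hg
      · intro hf; exact ⟨f, hf, rfl⟩
    refine isOpen_induced_iff.2 ⟨_, hQ, ?_⟩
    ext x
    constructor
    · rintro ⟨f, hf, hfx⟩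
      obtain ⟨_, g, rfl, hg⟩ := x
      have hgS : g ∈ S := hsat f g hfx hf
      obtain ⟨τ, hτ⟩ := hgS
      refine ⟨⟨_, hτ.2⟩, hτ.1, Subtype.ext ?_⟩
      refine Eq.trans ?_ (mk_plift hg)
      apply Quotient.sound
      change Set.range _ = Set.range _
      exact τ.surjective.range_comp (fun i => pCircle (plift (par (g.1 i))))
    · rintro ⟨p, hp, rfl⟩
      refine ⟨pliftT p, ⟨1, ?_⟩, rfl⟩
      have : (fun i => par ((pliftT p).1 ((1 : Equiv.Perm (Fin n)) i))) = p.1 := by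
        funext i; exact par_plift (p.2.1 i)
      rw [this]; exact ⟨hp, p.2⟩

end URProof

theorem statement11 (n : ℕ) (x : ↥(URConf n)) :
    Nonempty (FundamentalGroup (↥(URConf n)) x ≃* PresentedGroup (urRels n)) :=
  URProof.main_iso' (URProof.quo_q n) x
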